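/- arXiv:2007.10888 — 3 statements merged into one kernel-verified Lean document; each statement's English description precedes it below -/
import Mathlib

section
/- Let f ∈ C₀^∞(ℝ³). Let s, a, b satisfy 1/2 − 1/b = s, 3(1/a − 1/2) = 2/s − 4, with 2 < b < ∞ and 1 ≤ a < 2. Then there exists a constant C (depending only on a, b, s) such that ‖f‖_{L^b(ℝ³)} ≤ C ‖∂₃ f‖_{L^a(ℝ³)}^s · ‖∇² f‖_{L²(ℝ³)}^{1−s}. -/
open MeasureTheory

noncomputable section

abbrev E3 := EuclideanSpace ℝ (Fin 3)

/-- Partial derivative in the `i`-th coordinate direction. -/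
def pd (i : Fin 3) (f : E3 → ℝ) : E3 → ℝ :=
  fun x => fderiv ℝ f x (EuclideanSpace.single i 1)

/-- The fundamental theorem of calculus for `|u| ^ p` along a line. -/
lemma enorm_rpow_le_lintegral_rpow_mul_deriv {u u' : ℝ → ℝ} (hu : ContDiff ℝ 1 u)
    (hu' : ∀ t, HasDerivAt u (u' t) t) (hc : HasCompactSupport u) {p : ℝ} (hp : 1 < p) (t : ℝ) :
    ‖u t‖ₑ ^ p ≤ ENNReal.ofReal p * ∫⁻ x, ‖u x‖ₑ ^ (p - 1) * ‖u' x‖ₑ := by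
  have hsm : ContDiff ℝ 1 (fun x => ‖u x‖ ^ p) := (contDiff_norm_rpow hp).comp hu
  have hcs : HasCompactSupport (fun x => ‖u x‖ ^ p) :=
    hc.comp_left (g := fun y : ℝ => ‖y‖ ^ p)
      (by simp [Real.zero_rpow (show p ≠ 0 by linarith)])
  have hder (x : ℝ) : ‖deriv (fun x => ‖u x‖ ^ p) x‖ₑ =
      ENNReal.ofReal p * (‖u x‖ₑ ^ (p - 1) * ‖u' x‖ₑ) := by
    have h : HasDerivAt (fun x => ‖u x‖ ^ p) (p * |u x| ^ (p - 2) * u x * u' x) x :=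
      (hasDerivAt_abs_rpow (u x) hp).comp x (hu' x)
    rw [h.deriv, enorm_mul, ← mul_assoc]
    congr 1
    rw [← ofReal_norm, ← ofReal_norm,
      ENNReal.ofReal_rpow_of_nonneg (norm_nonneg _) (by linarith),
      ← ENNReal.ofReal_mul (by linarith)]
    congr 1
    rw [norm_mul, norm_mul, Real.norm_of_nonneg (show 0 ≤ p by linarith),
      Real.norm_of_nonneg (by positivity), Real.norm_eq_abs, mul_assoc]
    congr 1
    rcases eq_or_ne (u x) 0 with h0 | h0
    · simp [h0, Real.zero_rpow (show p - 1 ≠ 0 by linarith)]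
    · rw [← Real.rpow_add_one (abs_ne_zero.mpr h0)]
      congr 1
      ring
  calc ‖u t‖ₑ ^ p = ‖‖u t‖ ^ p‖ₑ := by
        rw [Real.enorm_rpow_of_nonneg (norm_nonneg _) (by linarith), enorm_norm]
    _ ≤ ∫⁻ x in Set.Iic t, ‖deriv (fun x => ‖u x‖ ^ p) x‖ₑ :=
        HasCompactSupport.enorm_le_lintegral_Ici_deriv hsm hcs t
    _ ≤ ∫⁻ x, ‖deriv (fun x => ‖u x‖ ^ p) x‖ₑ := setLIntegral_le_lintegral _ _
    _ = _ := by
        simp_rw [hder]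
        rw [lintegral_const_mul' _ _ ENNReal.ofReal_ne_top]

/-- Integration by parts for a power of `u` times the square of its derivative. -/
lemma lintegral_rpow_mul_deriv_sq_le {u u' u'' : ℝ → ℝ} (hu' : ∀ t, HasDerivAt u (u' t) t)
    (hu'' : ∀ t, HasDerivAt u' (u'' t) t) (hcont : Continuous u'') (hc : HasCompactSupport u)
    {q : ℝ} (hq : 1 < q) :
    ∫⁻ x, ‖u x‖ₑ ^ q * ‖u' x‖ₑ ^ (2 : ℝ) ≤ ∫⁻ x, ‖u x‖ₑ ^ (q + 1) * ‖u'' x‖ₑ := by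
  have hq0 : 0 < q := by linarith
  have cu : Continuous u := continuous_iff_continuousAt.mpr fun t => (hu' t).continuousAt
  have cu' : Continuous u' := continuous_iff_continuousAt.mpr fun t => (hu'' t).continuousAt
  have cq : Continuous fun x => |u x| ^ q :=
    cu.abs.rpow_const fun _ => Or.inr hq0.le
  have cq1 : Continuous fun x => |u x| ^ (q + 1) :=
    cu.abs.rpow_const fun _ => Or.inr (by linarith)
  have hcq : HasCompactSupport fun x => |u x| ^ q :=
    hc.comp_left (g := fun y : ℝ => |y| ^ q) (by simp [Real.zero_rpow hq0.ne'])
  have hcq1 : HasCompactSupport fun x => |u x| ^ (q + 1) :=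
    hc.comp_left (g := fun y : ℝ => |y| ^ (q + 1))
      (by simp [Real.zero_rpow (show q + 1 ≠ 0 by linarith)])
  have hder (x : ℝ) : HasDerivAt (fun x => |u x| ^ q * u x * u' x)
      ((q + 1) * (|u x| ^ q * u' x ^ 2) + |u x| ^ q * u x * u'' x) x := by
    have h1 : HasDerivAt (fun x => |u x| ^ q) (q * |u x| ^ (q - 2) * u x * u' x) x :=
      (hasDerivAt_abs_rpow (u x) hq).comp x (hu' x)
    refine ((h1.mul (hu' x)).mul (hu'' x)).congr_deriv ?_
    have key : |u x| ^ (q - 2) * u x ^ 2 = |u x| ^ q := by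
      rcases eq_or_ne (u x) 0 with h0 | h0
      · simp [h0, Real.zero_rpow hq0.ne']
      · rw [← sq_abs, ← Real.rpow_natCast, ← Real.rpow_add (abs_pos.mpr h0)]
        congr 1
        push_cast
        ring
    simp only [Pi.mul_apply]
    rw [← key]
    ring
  have i1 : Integrable fun x => |u x| ^ q * u' x ^ 2 :=
    (cq.mul (cu'.pow 2)).integrable_of_hasCompactSupport hcq.mul_right
  have i2 : Integrable fun x => |u x| ^ q * u x * u'' x :=
    ((cq.mul cu).mul hcont).integrable_of_hasCompactSupport hcq.mul_right.mul_right
  have i3 : Integrable fun x => |u x| ^ q * u x * u' x :=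
    ((cq.mul cu).mul cu').integrable_of_hasCompactSupport hcq.mul_right.mul_right
  have i4 : Integrable fun x => |u x| ^ (q + 1) * |u'' x| :=
    (cq1.mul hcont.abs).integrable_of_hasCompactSupport hcq1.mul_right
  have hz := integral_eq_zero_of_hasDerivAt_of_integrable hder ((i1.const_mul _).add i2) i3
  rw [integral_add (i1.const_mul _) i2, integral_const_mul] at hz
  have hle : -∫ x, |u x| ^ q * u x * u'' x ≤ ∫ x, |u x| ^ (q + 1) * |u'' x| := by
    rw [← integral_neg]
    refine integral_mono i2.neg i4 fun x => ?_
    refine (neg_le_abs _).trans_eq ?_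
    rw [abs_mul, abs_mul, abs_of_nonneg (show 0 ≤ |u x| ^ q by positivity),
      Real.rpow_add_one' (abs_nonneg _) (by linarith)]
  have hpos : 0 ≤ ∫ x, |u x| ^ q * u' x ^ 2 := integral_nonneg fun x => by positivity
  have hmain : ∫ x, |u x| ^ q * u' x ^ 2 ≤ ∫ x, |u x| ^ (q + 1) * |u'' x| := by nlinarith
  have e1 (x : ℝ) : ‖u x‖ₑ ^ q * ‖u' x‖ₑ ^ (2 : ℝ) = ENNReal.ofReal (|u x| ^ q * u' x ^ 2) := by
    rw [ENNReal.ofReal_mul (by positivity), ← ENNReal.ofReal_rpow_of_nonneg (abs_nonneg _) hq0.le,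
      ← sq_abs, ENNReal.ofReal_pow (abs_nonneg _), ENNReal.rpow_ofNat,
      Real.enorm_eq_ofReal_abs, Real.enorm_eq_ofReal_abs]
  have e2 (x : ℝ) : ‖u x‖ₑ ^ (q + 1) * ‖u'' x‖ₑ =
      ENNReal.ofReal (|u x| ^ (q + 1) * |u'' x|) := by
    rw [ENNReal.ofReal_mul (by positivity),
      ← ENNReal.ofReal_rpow_of_nonneg (abs_nonneg _) (by linarith),
      Real.enorm_eq_ofReal_abs, Real.enorm_eq_ofReal_abs]
  simp_rw [e1, e2]
  rw [← ofReal_integral_eq_lintegral_ofReal i1 (.of_forall fun x => by positivity),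
    ← ofReal_integral_eq_lintegral_ofReal i4 (.of_forall fun x => by positivity)]
  exact ENNReal.ofReal_le_ofReal hmain

/-- The Cauchy–Schwarz inequality for lower Lebesgue integrals. -/
lemma lintegral_sqrt_mul_sqrt_le {α : Type*} [MeasurableSpace α] {μ : Measure α}
    {f g : α → ENNReal} (hf : AEMeasurable f μ) (hg : AEMeasurable g μ) :
    ∫⁻ x, f x ^ (1 / 2 : ℝ) * g x ^ (1 / 2 : ℝ) ∂μ ≤
      (∫⁻ x, f x ∂μ) ^ (1 / 2 : ℝ) * (∫⁻ x, g x ∂μ) ^ (1 / 2 : ℝ) :=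
  ENNReal.lintegral_mul_norm_pow_le hf hg (by norm_num) (by norm_num) (by norm_num)

lemma ENNReal.rpow_rpow_of_mul_eq (x : ENNReal) {y z w : ℝ} (h : y * z = w) :
    (x ^ y) ^ z = x ^ w := by
  rw [← ENNReal.rpow_mul, h]

lemma lintegral_rpow_mul_le_of_lintegral_rpow_mul_sq_le {α : Type*} [MeasurableSpace α]
    {μ : Measure α} {φ d e : α → ENNReal} (hφ : Measurable φ) (hd : Measurable d)
    (he : Measurable e) {q : ℝ}
    (h : ∫⁻ x, φ x ^ q * d x ^ (2 : ℝ) ∂μ ≤ ∫⁻ x, φ x ^ (q + 1) * e x ∂μ) :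
    ∫⁻ x, φ x ^ q * d x ∂μ ≤ (∫⁻ x, φ x ^ q ∂μ) ^ (1 / 2 : ℝ) *
      ((∫⁻ x, φ x ^ (2 * q + 2) ∂μ) ^ (1 / 2 : ℝ) *
        (∫⁻ x, e x ^ (2 : ℝ) ∂μ) ^ (1 / 2 : ℝ)) ^ (1 / 2 : ℝ) := by
  have h1 (x : α) : φ x ^ q * d x =
      (φ x ^ q) ^ (1 / 2 : ℝ) * (φ x ^ q * d x ^ (2 : ℝ)) ^ (1 / 2 : ℝ) := by
    rw [ENNReal.mul_rpow_of_nonneg _ _ (by norm_num), ← mul_assoc,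
      ← ENNReal.rpow_add_of_nonneg _ _ (by norm_num) (by norm_num),
      ENNReal.rpow_rpow_of_mul_eq (d x) (show (2 : ℝ) * (1 / 2) = 1 by norm_num)]
    norm_num
  have h2 (x : α) : φ x ^ (q + 1) * e x =
      (φ x ^ (2 * q + 2)) ^ (1 / 2 : ℝ) * (e x ^ (2 : ℝ)) ^ (1 / 2 : ℝ) := by
    rw [ENNReal.rpow_rpow_of_mul_eq (φ x) (show (2 * q + 2) * (1 / 2) = q + 1 by ring),
      ENNReal.rpow_rpow_of_mul_eq (e x) (show (2 : ℝ) * (1 / 2) = 1 by norm_num), ENNReal.rpow_one]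
  calc ∫⁻ x, φ x ^ q * d x ∂μ
      = ∫⁻ x, (φ x ^ q) ^ (1 / 2 : ℝ) * (φ x ^ q * d x ^ (2 : ℝ)) ^ (1 / 2 : ℝ) ∂μ := by
        simp_rw [← h1]
    _ ≤ (∫⁻ x, φ x ^ q ∂μ) ^ (1 / 2 : ℝ) *
        (∫⁻ x, φ x ^ q * d x ^ (2 : ℝ) ∂μ) ^ (1 / 2 : ℝ) :=
        lintegral_sqrt_mul_sqrt_le (by fun_prop) (by fun_prop)
    _ ≤ _ := by
        gcongr
        refine h.trans ?_
        simp_rw [h2]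
        exact lintegral_sqrt_mul_sqrt_le (by fun_prop) (by fun_prop)

/-- A Gagliardo–Nirenberg inequality in the plane, with the derivatives abstracted. -/
lemma lintegral_plane_rpow_le {φ d₁ d₂ e : ℝ × ℝ → ENNReal} (hφ : Measurable φ)
    (hd₁ : Measurable d₁) (hd₂ : Measurable d₂) (he : Measurable e) {q : ℝ} (hq : 0 < q)
    {c : ENNReal}
    (H₁ : ∀ x y, φ (x, y) ^ (q + 1) ≤ c * ∫⁻ t, φ (t, y) ^ q * d₁ (t, y))
    (H₂ : ∀ x y, φ (x, y) ^ (q + 1) ≤ c * ∫⁻ t, φ (x, t) ^ q * d₂ (x, t))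
    (P₁ : ∀ y, ∫⁻ x, φ (x, y) ^ q * d₁ (x, y) ^ (2 : ℝ) ≤ ∫⁻ x, φ (x, y) ^ (q + 1) * e (x, y))
    (P₂ : ∀ x, ∫⁻ y, φ (x, y) ^ q * d₂ (x, y) ^ (2 : ℝ) ≤ ∫⁻ y, φ (x, y) ^ (q + 1) * e (x, y)) :
    ∫⁻ p, φ p ^ (2 * q + 2) ≤ c ^ 2 * ((∫⁻ p, φ p ^ q) *
      ((∫⁻ p, φ p ^ (2 * q + 2)) ^ (1 / 2 : ℝ) * (∫⁻ p, e p ^ (2 : ℝ)) ^ (1 / 2 : ℝ))) := by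
  have G₁ := lintegral_rpow_mul_le_of_lintegral_rpow_mul_sq_le (μ := volume) (q := q) hφ hd₁ he (by
    simp_rw [Measure.volume_eq_prod]
    rw [lintegral_prod_symm' _ (by fun_prop), lintegral_prod_symm' _ (by fun_prop)]
    exact lintegral_mono P₁)
  have G₂ := lintegral_rpow_mul_le_of_lintegral_rpow_mul_sq_le (μ := volume) (q := q) hφ hd₂ he (by
    simp_rw [Measure.volume_eq_prod]
    rw [lintegral_prod _ (by fun_prop), lintegral_prod _ (by fun_prop)]
    exact lintegral_mono P₂)
  set R := (∫⁻ p, φ p ^ (2 * q + 2)) ^ (1 / 2 : ℝ) * (∫⁻ p, e p ^ (2 : ℝ)) ^ (1 / 2 : ℝ)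
  have hU : Measurable fun y => ∫⁻ t, φ (t, y) ^ q * d₁ (t, y) :=
    Measurable.lintegral_prod_left' (f := fun p : ℝ × ℝ => φ p ^ q * d₁ p) (by fun_prop)
  have hV : Measurable fun x => ∫⁻ t, φ (x, t) ^ q * d₂ (x, t) :=
    Measurable.lintegral_prod_right' (f := fun p : ℝ × ℝ => φ p ^ q * d₂ p) (by fun_prop)
  calc ∫⁻ p, φ p ^ (2 * q + 2)
      ≤ ∫⁻ p : ℝ × ℝ, c ^ 2 * ((∫⁻ t, φ (p.1, t) ^ q * d₂ (p.1, t)) *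
          ∫⁻ t, φ (t, p.2) ^ q * d₁ (t, p.2)) := by
        refine lintegral_mono fun p => ?_
        calc φ p ^ (2 * q + 2) = φ p ^ (q + 1) * φ p ^ (q + 1) := by
              rw [← ENNReal.rpow_add_of_nonneg _ _ (by linarith) (by linarith)]
              congr 1
              ring
          _ ≤ (c * ∫⁻ t, φ (p.1, t) ^ q * d₂ (p.1, t)) *
                (c * ∫⁻ t, φ (t, p.2) ^ q * d₁ (t, p.2)) :=
              mul_le_mul' (H₂ p.1 p.2) (H₁ p.1 p.2)
          _ = _ := by ring
    _ = c ^ 2 * ((∫⁻ p, φ p ^ q * d₂ p) * ∫⁻ p, φ p ^ q * d₁ p) := by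
        rw [lintegral_const_mul _ (by fun_prop)]
        simp_rw [Measure.volume_eq_prod]
        rw [lintegral_prod_mul hV.aemeasurable hU.aemeasurable,
          lintegral_prod _ (by fun_prop), lintegral_prod_symm' _ (by fun_prop)]
    _ ≤ c ^ 2 * (((∫⁻ p, φ p ^ q) ^ (1 / 2 : ℝ) * R ^ (1 / 2 : ℝ)) *
          ((∫⁻ p, φ p ^ q) ^ (1 / 2 : ℝ) * R ^ (1 / 2 : ℝ))) := by gcongr
    _ = _ := by
        rw [← ENNReal.mul_rpow_of_nonneg _ _ (by norm_num),
          ← ENNReal.rpow_add_of_nonneg _ _ (by norm_num) (by norm_num)]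
        norm_num

/-- The three-dimensional version of `lintegral_plane_rpow_le`, where only a first derivative is
used in the third direction. -/
lemma lintegral_space_rpow_le {φ d₁ d₂ d₃ e : (ℝ × ℝ) × ℝ → ENNReal} (hφ : Measurable φ)
    (hd₁ : Measurable d₁) (hd₂ : Measurable d₂) (hd₃ : Measurable d₃) (he : Measurable e) {q : ℝ}
    (hq : 0 < q) {c : ENNReal}
    (H₁ : ∀ x y z, φ ((x, y), z) ^ (q + 1) ≤ c * ∫⁻ t, φ ((t, y), z) ^ q * d₁ ((t, y), z))
    (H₂ : ∀ x y z, φ ((x, y), z) ^ (q + 1) ≤ c * ∫⁻ t, φ ((x, t), z) ^ q * d₂ ((x, t), z))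
    (H₃ : ∀ p z, φ (p, z) ^ q ≤ c * ∫⁻ t, φ (p, t) ^ (q - 1) * d₃ (p, t))
    (P₁ : ∀ y z, ∫⁻ x, φ ((x, y), z) ^ q * d₁ ((x, y), z) ^ (2 : ℝ) ≤
      ∫⁻ x, φ ((x, y), z) ^ (q + 1) * e ((x, y), z))
    (P₂ : ∀ x z, ∫⁻ y, φ ((x, y), z) ^ q * d₂ ((x, y), z) ^ (2 : ℝ) ≤
      ∫⁻ y, φ ((x, y), z) ^ (q + 1) * e ((x, y), z)) :
    ∫⁻ v, φ v ^ (2 * q + 2) ≤ c ^ 3 * ((∫⁻ v, φ v ^ (q - 1) * d₃ v) *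
      ((∫⁻ v, φ v ^ (2 * q + 2)) ^ (1 / 2 : ℝ) * (∫⁻ v, e v ^ (2 : ℝ)) ^ (1 / 2 : ℝ))) := by
  have hplane (z : ℝ) := lintegral_plane_rpow_le (φ := fun p => φ (p, z))
    (d₁ := fun p => d₁ (p, z)) (d₂ := fun p => d₂ (p, z)) (e := fun p => e (p, z))
    (by fun_prop) (by fun_prop) (by fun_prop) (by fun_prop) hq (fun x y => H₁ x y z)
    (fun x y => H₂ x y z) (fun y => P₁ y z) (fun x => P₂ x z)
  have hN (z : ℝ) : ∫⁻ p : ℝ × ℝ, φ (p, z) ^ q ≤ c * ∫⁻ v, φ v ^ (q - 1) * d₃ v := by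
    have hm : Measurable fun p => ∫⁻ t, φ (p, t) ^ (q - 1) * d₃ (p, t) :=
      Measurable.lintegral_prod_right' (f := fun v : (ℝ × ℝ) × ℝ => φ v ^ (q - 1) * d₃ v)
        (by fun_prop)
    refine (lintegral_mono fun p => H₃ p z).trans_eq ?_
    rw [lintegral_const_mul _ hm, Measure.volume_eq_prod (ℝ × ℝ) ℝ,
      lintegral_prod _ (by fun_prop)]
  have hA : Measurable fun z => ∫⁻ p : ℝ × ℝ, φ (p, z) ^ (2 * q + 2) :=
    Measurable.lintegral_prod_left' (f := fun v : (ℝ × ℝ) × ℝ => φ v ^ (2 * q + 2)) (by fun_prop)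
  have hB : Measurable fun z => ∫⁻ p : ℝ × ℝ, e (p, z) ^ (2 : ℝ) :=
    Measurable.lintegral_prod_left' (f := fun v : (ℝ × ℝ) × ℝ => e v ^ (2 : ℝ)) (by fun_prop)
  have fub (F : (ℝ × ℝ) × ℝ → ENNReal) (hF : Measurable F) :
      ∫⁻ v, F v = ∫⁻ z, ∫⁻ p : ℝ × ℝ, F (p, z) := by
    rw [Measure.volume_eq_prod (ℝ × ℝ) ℝ, lintegral_prod_symm' _ hF]
  calc ∫⁻ v, φ v ^ (2 * q + 2) = ∫⁻ z, ∫⁻ p : ℝ × ℝ, φ (p, z) ^ (2 * q + 2) :=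
        fub _ (by fun_prop)
    _ ≤ ∫⁻ z, c ^ 2 * (c * ∫⁻ v, φ v ^ (q - 1) * d₃ v) *
          ((∫⁻ p : ℝ × ℝ, φ (p, z) ^ (2 * q + 2)) ^ (1 / 2 : ℝ) *
            (∫⁻ p : ℝ × ℝ, e (p, z) ^ (2 : ℝ)) ^ (1 / 2 : ℝ)) := by
        refine lintegral_mono fun z => (hplane z).trans ?_
        rw [mul_assoc]
        gcongr
        exact hN z
    _ = c ^ 2 * (c * ∫⁻ v, φ v ^ (q - 1) * d₃ v) *
          ∫⁻ z, ((∫⁻ p : ℝ × ℝ, φ (p, z) ^ (2 * q + 2)) ^ (1 / 2 : ℝ) *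
            (∫⁻ p : ℝ × ℝ, e (p, z) ^ (2 : ℝ)) ^ (1 / 2 : ℝ)) :=
        lintegral_const_mul _ (by fun_prop)
    _ ≤ c ^ 2 * (c * ∫⁻ v, φ v ^ (q - 1) * d₃ v) *
          ((∫⁻ v, φ v ^ (2 * q + 2)) ^ (1 / 2 : ℝ) * (∫⁻ v, e v ^ (2 : ℝ)) ^ (1 / 2 : ℝ)) := by
        gcongr
        rw [fub _ (show Measurable fun v => φ v ^ (2 * q + 2) by fun_prop),
          fub _ (show Measurable fun v => e v ^ (2 : ℝ) by fun_prop)]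
        exact lintegral_sqrt_mul_sqrt_le hA.aemeasurable hB.aemeasurable
    _ = _ := by ring

/-- Points of `E3` described by their horizontal and vertical coordinates. -/
def ofCoords (v : (ℝ × ℝ) × ℝ) : E3 := !₂[v.1.1, v.1.2, v.2]

lemma continuous_ofCoords : Continuous ofCoords := by
  unfold ofCoords
  refine (PiLp.continuous_toLp 2 _).comp (continuous_pi fun i => ?_)
  fin_cases i <;> simp <;> fun_prop

lemma lintegral_ofCoords {F : E3 → ENNReal} (hF : Measurable F) :
    ∫⁻ x, F x = ∫⁻ v, F (ofCoords v) := by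
  have h1 := EuclideanSpace.volume_preserving_symm_measurableEquiv_toLp (Fin 3)
  have h2 := volume_preserving_piFinSuccAbove (fun _ : Fin 3 => ℝ) 2
  have h3 := (MeasurePreserving.id (volume : Measure ℝ)).prod
    (volume_preserving_finTwoArrow ℝ)
  have h4 : MeasurePreserving (Prod.swap : ℝ × (ℝ × ℝ) → (ℝ × ℝ) × ℝ) volume volume :=
    Measure.measurePreserving_swap
  have h := h4.comp (h3.comp (h2.comp h1))
  refine Eq.trans ?_ (h.lintegral_comp (hF.comp continuous_ofCoords.measurable))
  refine lintegral_congr fun x => ?_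
  congr 1
  ext i
  fin_cases i <;> rfl

lemma contDiff_pd {f : E3 → ℝ} (hf : ContDiff ℝ (⊤ : ℕ∞) f) (i : Fin 3) :
    ContDiff ℝ (⊤ : ℕ∞) (pd i f) :=
  (hf.fderiv_right (m := (⊤ : ℕ∞)) (by simp)).clm_apply contDiff_const

lemma fderiv_pd_apply {f : E3 → ℝ} (hf : ContDiff ℝ (⊤ : ℕ∞) f) (i : Fin 3) (x v : E3) :
    fderiv ℝ (pd i f) x v = iteratedFDeriv ℝ 2 f x ![v, EuclideanSpace.single i 1] := by
  have hd : DifferentiableAt ℝ (fderiv ℝ f) x :=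
    (hf.fderiv_right (m := (⊤ : ℕ∞)) (by simp)).differentiable (by simp) x
  have h : HasFDerivAt (pd i f)
      ((ContinuousLinearMap.apply ℝ ℝ (EuclideanSpace.single i (1 : ℝ))).comp
        (fderiv ℝ (fderiv ℝ f) x)) x :=
    (ContinuousLinearMap.apply ℝ ℝ (EuclideanSpace.single i (1 : ℝ))).hasFDerivAt.comp x
      hd.hasFDerivAt
  rw [h.fderiv, iteratedFDeriv_two_apply]
  simp

lemma norm_fderiv_pd_le {f : E3 → ℝ} (hf : ContDiff ℝ (⊤ : ℕ∞) f) (i : Fin 3) (x : E3) :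
    ‖fderiv ℝ (pd i f) x‖ ≤ ‖iteratedFDeriv ℝ 2 f x‖ := by
  refine ContinuousLinearMap.opNorm_le_bound _ (norm_nonneg _) fun v => ?_
  rw [fderiv_pd_apply hf]
  refine (ContinuousMultilinearMap.le_opNorm _ _).trans_eq ?_
  simp [Fin.prod_univ_two]

lemma norm_pd_pd_le {f : E3 → ℝ} (hf : ContDiff ℝ (⊤ : ℕ∞) f) (i : Fin 3) (x : E3) :
    ‖pd i (pd i f) x‖ ≤ ‖iteratedFDeriv ℝ 2 f x‖ := by
  refine le_trans ?_ (norm_fderiv_pd_le hf i x)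
  refine (ContinuousLinearMap.le_opNorm _ _).trans_eq ?_
  simp

lemma hasDerivAt_comp_line {f : E3 → ℝ} (hf : ContDiff ℝ (⊤ : ℕ∞) f) (i : Fin 3) (w : E3)
    (t : ℝ) : HasDerivAt (fun t : ℝ => f (w + t • EuclideanSpace.single i (1 : ℝ)))
      (pd i f (w + t • EuclideanSpace.single i (1 : ℝ))) t := by
  have h : HasDerivAt (fun t : ℝ => w + t • EuclideanSpace.single i (1 : ℝ))
      (EuclideanSpace.single i (1 : ℝ)) t := by
    simpa using ((hasDerivAt_id t).smul_const (EuclideanSpace.single i (1 : ℝ))).const_add w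
  exact (hf.differentiable (by simp) _).hasFDerivAt.comp_hasDerivAt t h

lemma hasCompactSupport_comp_line {f : E3 → ℝ} (hc : HasCompactSupport f) (i : Fin 3) (w : E3) :
    HasCompactSupport (fun t : ℝ => f (w + t • EuclideanSpace.single i (1 : ℝ))) := by
  have h : Isometry (fun t : ℝ => w + t • EuclideanSpace.single i (1 : ℝ)) :=
    Isometry.of_dist_eq fun t t' => by
      rw [dist_add_left, dist_eq_norm, ← sub_smul, norm_smul]
      simp [Real.dist_eq]
  exact hc.comp_isClosedEmbedding h.isClosedEmbedding

lemma enorm_rpow_le_lintegral_line {f : E3 → ℝ} (hf : ContDiff ℝ (⊤ : ℕ∞) f)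
    (hc : HasCompactSupport f) {i : Fin 3} {γ : ℝ → E3}
    (hγ : ∀ t, γ t = γ 0 + t • EuclideanSpace.single i (1 : ℝ)) {p : ℝ} (hp : 1 < p) (t : ℝ) :
    ‖f (γ t)‖ₑ ^ p ≤ ENNReal.ofReal p * ∫⁻ x, ‖f (γ x)‖ₑ ^ (p - 1) * ‖pd i f (γ x)‖ₑ := by
  generalize γ 0 = w at hγ
  obtain rfl : γ = _ := funext hγ
  refine enorm_rpow_le_lintegral_rpow_mul_deriv
    (u := fun t : ℝ => f (w + t • EuclideanSpace.single i (1 : ℝ)))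
    (u' := fun t : ℝ => pd i f (w + t • EuclideanSpace.single i (1 : ℝ)))
    ((hf.of_le (by simp)).comp (by fun_prop)) (hasDerivAt_comp_line hf i w)
    (hasCompactSupport_comp_line hc i w) hp t

lemma lintegral_line_rpow_mul_sq_le {f : E3 → ℝ} (hf : ContDiff ℝ (⊤ : ℕ∞) f)
    (hc : HasCompactSupport f) {i : Fin 3} {γ : ℝ → E3}
    (hγ : ∀ t, γ t = γ 0 + t • EuclideanSpace.single i (1 : ℝ)) {q : ℝ} (hq : 1 < q) :
    ∫⁻ x, ‖f (γ x)‖ₑ ^ q * ‖pd i f (γ x)‖ₑ ^ (2 : ℝ) ≤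
      ∫⁻ x, ‖f (γ x)‖ₑ ^ (q + 1) * ‖iteratedFDeriv ℝ 2 f (γ x)‖ₑ := by
  generalize γ 0 = w at hγ
  obtain rfl : γ = _ := funext hγ
  refine (lintegral_rpow_mul_deriv_sq_le
    (u := fun t : ℝ => f (w + t • EuclideanSpace.single i (1 : ℝ)))
    (hasDerivAt_comp_line hf i w) (hasDerivAt_comp_line (contDiff_pd hf i) i w)
    ((contDiff_pd (contDiff_pd hf i) i).continuous.comp (by fun_prop))
    (hasCompactSupport_comp_line hc i w) hq).trans (lintegral_mono fun x => ?_)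
  gcongr
  exact enorm_le_iff_norm_le.mpr (norm_pd_pd_le hf i _)

lemma lintegral_enorm_rpow_le {f : E3 → ℝ} (hf : ContDiff ℝ (⊤ : ℕ∞) f)
    (hc : HasCompactSupport f) {q : ℝ} (hq : 1 < q) :
    ∫⁻ x, ‖f x‖ₑ ^ (2 * q + 2) ≤ ENNReal.ofReal (q + 1) ^ 3 *
      ((∫⁻ x, ‖f x‖ₑ ^ (q - 1) * ‖pd 2 f x‖ₑ) * ((∫⁻ x, ‖f x‖ₑ ^ (2 * q + 2)) ^ (1 / 2 : ℝ) *
        (∫⁻ x, ‖iteratedFDeriv ℝ 2 f x‖ₑ ^ (2 : ℝ)) ^ (1 / 2 : ℝ))) := by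
  have cf : Continuous f := hf.continuous
  have cd (i : Fin 3) : Continuous (pd i f) := (contDiff_pd hf i).continuous
  have ch : Continuous (iteratedFDeriv ℝ 2 f) :=
    hf.continuous_iteratedFDeriv (WithTop.coe_le_coe.mpr le_top)
  have co := continuous_ofCoords
  have l0 (y z t : ℝ) : ofCoords ((t, y), z) =
      ofCoords ((0, y), z) + t • EuclideanSpace.single 0 (1 : ℝ) := by
    ext i; fin_cases i <;> simp [ofCoords]
  have l1 (x z t : ℝ) : ofCoords ((x, t), z) =
      ofCoords ((x, 0), z) + t • EuclideanSpace.single 1 (1 : ℝ) := by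
    ext i; fin_cases i <;> simp [ofCoords]
  have l2 (p : ℝ × ℝ) (t : ℝ) : ofCoords (p, t) =
      ofCoords (p, 0) + t • EuclideanSpace.single 2 (1 : ℝ) := by
    ext i; fin_cases i <;> simp [ofCoords]
  rw [lintegral_ofCoords (F := fun x => ‖f x‖ₑ ^ (2 * q + 2))
      (by fun_prop),
    lintegral_ofCoords (F := fun x => ‖f x‖ₑ ^ (q - 1) * ‖pd 2 f x‖ₑ)
      ((cf.enorm.measurable.pow_const _).mul (cd 2).enorm.measurable),
    lintegral_ofCoords (F := fun x => ‖iteratedFDeriv ℝ 2 f x‖ₑ ^ (2 : ℝ))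
      (ch.enorm.measurable.pow_const _)]
  refine lintegral_space_rpow_le (φ := fun v => ‖f (ofCoords v)‖ₑ)
    (d₁ := fun v => ‖pd 0 f (ofCoords v)‖ₑ) (d₂ := fun v => ‖pd 1 f (ofCoords v)‖ₑ)
    (d₃ := fun v => ‖pd 2 f (ofCoords v)‖ₑ) (e := fun v => ‖iteratedFDeriv ℝ 2 f (ofCoords v)‖ₑ)
    (cf.comp co).enorm.measurable ((cd 0).comp co).enorm.measurable
    ((cd 1).comp co).enorm.measurable ((cd 2).comp co).enorm.measurable
    (ch.comp co).enorm.measurable (by linarith) ?_ ?_ ?_ ?_ ?_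
  · intro x y z
    simpa using enorm_rpow_le_lintegral_line hf hc (l0 y z) (p := q + 1) (by linarith) x
  · intro x y z
    simpa using enorm_rpow_le_lintegral_line hf hc (l1 x z) (p := q + 1) (by linarith) y
  · intro p z
    refine (enorm_rpow_le_lintegral_line hf hc (l2 p) hq z).trans ?_
    gcongr
    linarith
  · intro y z
    exact lintegral_line_rpow_mul_sq_le hf hc (l0 y z) hq
  · intro x z
    exact lintegral_line_rpow_mul_sq_le hf hc (l1 x z) hq

lemma eLpNorm_ofReal {α F : Type*} [MeasurableSpace α] [NormedAddCommGroup F] {μ : Measure α}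
    (g : α → F) {p : ℝ} (hp : 0 < p) :
    eLpNorm g (ENNReal.ofReal p) μ = (∫⁻ x, ‖g x‖ₑ ^ p ∂μ) ^ (1 / p) := by
  rw [eLpNorm_eq_lintegral_rpow_enorm_toReal (by simpa using hp) ENNReal.ofReal_ne_top,
    ENNReal.toReal_ofReal hp.le]

/-- Log-convexity of `p ↦ ‖g‖_p`. -/
lemma eLpNorm_le_rpow_mul_rpow {α F : Type*} [MeasurableSpace α] [NormedAddCommGroup F]
    {μ : Measure α} {g : α → F} (hg : AEStronglyMeasurable g μ) {p₀ p₁ r θ : ℝ} (hp₀ : 0 < p₀)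
    (hp₁ : 0 < p₁) (hr : 0 < r) (hθ₀ : 0 ≤ θ) (hθ₁ : θ ≤ 1) (h : 1 / r = θ / p₀ + (1 - θ) / p₁) :
    eLpNorm g (ENNReal.ofReal r) μ ≤
      eLpNorm g (ENNReal.ofReal p₀) μ ^ θ * eLpNorm g (ENNReal.ofReal p₁) μ ^ (1 - θ) := by
  rw [eLpNorm_ofReal g hp₀, eLpNorm_ofReal g hp₁, eLpNorm_ofReal g hr]
  have hθ' : 0 ≤ 1 - θ := by linarith
  have e₀ : 0 ≤ θ / p₀ * r := by positivity
  have e₁ : 0 ≤ (1 - θ) / p₁ * r := by positivity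
  have hsum : θ / p₀ * r + (1 - θ) / p₁ * r = 1 := by
    rw [← add_mul, ← h, one_div_mul_cancel hr.ne']
  have key := ENNReal.lintegral_mul_norm_pow_le (μ := μ) (f := fun x => ‖g x‖ₑ ^ p₀)
    (g := fun x => ‖g x‖ₑ ^ p₁) (hg.enorm.pow_const _) (hg.enorm.pow_const _) e₀ e₁ hsum
  have hx (x : α) : (‖g x‖ₑ ^ p₀) ^ (θ / p₀ * r) * (‖g x‖ₑ ^ p₁) ^ ((1 - θ) / p₁ * r) =
      ‖g x‖ₑ ^ r := by
    rw [ENNReal.rpow_rpow_of_mul_eq _ (show p₀ * (θ / p₀ * r) = θ * r by field_simp),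
      ENNReal.rpow_rpow_of_mul_eq _ (show p₁ * ((1 - θ) / p₁ * r) = (1 - θ) * r by field_simp),
      ← ENNReal.rpow_add_of_nonneg _ _ (by positivity) (by positivity)]
    congr 1
    ring
  simp_rw [hx] at key
  refine (ENNReal.rpow_le_rpow key (by positivity : 0 ≤ 1 / r)).trans_eq ?_
  rw [ENNReal.mul_rpow_of_nonneg _ _ (by positivity),
    ENNReal.rpow_rpow_of_mul_eq _ (show θ / p₀ * r * (1 / r) = θ / p₀ by field_simp),
    ENNReal.rpow_rpow_of_mul_eq _ (show (1 - θ) / p₁ * r * (1 / r) = (1 - θ) / p₁ by field_simp),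
    ENNReal.rpow_rpow_of_mul_eq _ (show 1 / p₀ * θ = θ / p₀ by ring),
    ENNReal.rpow_rpow_of_mul_eq _ (show 1 / p₁ * (1 - θ) = (1 - θ) / p₁ by ring)]

/-- The case `s = 1 / 2`, with `1 / r = 1 / 2 + 2 / b`. -/
lemma eLpNorm_le_sqrt_mul_sqrt {f : E3 → ℝ} (hf : ContDiff ℝ (⊤ : ℕ∞) f)
    (hc : HasCompactSupport f) {b r : ℝ} (hb : 4 < b) (hr : 0 < r) (hbr : 1 / r = 1 / 2 + 2 / b) :
    eLpNorm f (ENNReal.ofReal b) volume ≤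
      (ENNReal.ofReal (b / 2) ^ 3 * (eLpNorm (pd 2 f) (ENNReal.ofReal r) volume *
        eLpNorm (fun x => ‖iteratedFDeriv ℝ 2 f x‖) 2 volume)) ^ (1 / 2 : ℝ) := by
  have hb0 : 0 < b := by linarith
  have hfin : eLpNorm f (ENNReal.ofReal b) volume ≠ ⊤ :=
    (hf.continuous.memLp_of_hasCompactSupport hc).eLpNorm_ne_top
  have hmain := lintegral_enorm_rpow_le hf hc (q := b / 2 - 1) (by linarith)
  rw [show 2 * (b / 2 - 1) + 2 = b by ring, show b / 2 - 1 + 1 = b / 2 by ring] at hmain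
  have hK : eLpNorm (fun x => ‖iteratedFDeriv ℝ 2 f x‖) 2 volume =
      (∫⁻ x, ‖iteratedFDeriv ℝ 2 f x‖ₑ ^ (2 : ℝ)) ^ (1 / 2 : ℝ) := by
    rw [eLpNorm_norm, eLpNorm_eq_lintegral_rpow_enorm_toReal (by simp) (by simp)]
    simp
  rw [← hK] at hmain
  rw [eLpNorm_ofReal f hb0] at hfin ⊢
  set K := eLpNorm (fun x => ‖iteratedFDeriv ℝ 2 f x‖) 2 volume
  set c := ENNReal.ofReal (b / 2)
  have hJ : ∫⁻ x, ‖f x‖ₑ ^ (b / 2 - 1 - 1) * ‖pd 2 f x‖ₑ ≤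
      (∫⁻ x, ‖f x‖ₑ ^ b) ^ (1 / 2 - 2 / b) * eLpNorm (pd 2 f) (ENNReal.ofReal r) volume := by
    have h2b : 2 / b < 1 / 2 := by
      rw [div_lt_div_iff₀ hb0 (by norm_num)]
      linarith
    have key := ENNReal.lintegral_mul_norm_pow_le (μ := volume) (f := fun x => ‖f x‖ₑ ^ b)
      (g := fun x => ‖pd 2 f x‖ₑ ^ r) (hf.continuous.enorm.measurable.pow_const _).aemeasurable
      ((contDiff_pd hf 2).continuous.enorm.measurable.pow_const _).aemeasurable
      (p := 1 / 2 - 2 / b) (q := 1 / r) (by linarith) (by positivity) (by rw [hbr]; ring)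
    rw [eLpNorm_ofReal _ hr]
    refine le_of_eq_of_le (lintegral_congr fun x => ?_) key
    rw [ENNReal.rpow_rpow_of_mul_eq _
        (show b * (1 / 2 - 2 / b) = b / 2 - 1 - 1 by field_simp; ring),
      ENNReal.rpow_rpow_of_mul_eq _ (show r * (1 / r) = 1 by field_simp), ENNReal.rpow_one]
  set D := eLpNorm (pd 2 f) (ENNReal.ofReal r) volume
  set I := ∫⁻ x, ‖f x‖ₑ ^ b
  rcases eq_or_ne I 0 with h0 | h0
  · rw [h0, ENNReal.zero_rpow_of_pos (by positivity)]
    exact zero_le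
  have hI : I ≠ ⊤ := fun h => hfin (by rw [h, ENNReal.top_rpow_of_pos (by positivity)])
  have hbound : I ^ (2 / b) * I ^ (1 - 2 / b) ≤ c ^ 3 * (D * K) * I ^ (1 - 2 / b) := by
    rw [← ENNReal.rpow_add _ _ h0 hI, add_sub_cancel, ENNReal.rpow_one]
    calc I ≤ c ^ 3 * ((I ^ (1 / 2 - 2 / b) * D) * (I ^ (1 / 2 : ℝ) * K)) := by
          refine hmain.trans ?_
          gcongr
      _ = c ^ 3 * (D * K) * (I ^ (1 / 2 - 2 / b) * I ^ (1 / 2 : ℝ)) := by ring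
      _ = _ := by
          rw [← ENNReal.rpow_add _ _ h0 hI]
          congr 2
          ring
  have hcancel : I ^ (2 / b) ≤ c ^ 3 * (D * K) :=
    (ENNReal.mul_le_mul_iff_left (ENNReal.rpow_pos (pos_iff_ne_zero.mpr h0) hI).ne'
      (ENNReal.rpow_ne_top_of_ne_zero h0 hI)).mp hbound
  refine le_of_eq_of_le ?_ (ENNReal.rpow_le_rpow hcancel (by norm_num : (0 : ℝ) ≤ 1 / 2))
  rw [ENNReal.rpow_rpow_of_mul_eq I (show 2 / b * (1 / 2) = 1 / b by ring)]

lemma exists_eLpNorm_pd_six_le : ∃ S : NNReal, ∀ f : E3 → ℝ, ContDiff ℝ (⊤ : ℕ∞) f →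
    HasCompactSupport f → ∀ i, eLpNorm (pd i f) (ENNReal.ofReal 6) volume ≤
      S * eLpNorm (fun x => ‖iteratedFDeriv ℝ 2 f x‖) 2 volume := by
  refine ⟨SNormLESNormFDerivOfEqConst ℝ (volume : Measure E3) (2 : NNReal), fun f hf hc i => ?_⟩
  have hcs : HasCompactSupport (pd i f) :=
    (hc.fderiv (𝕜 := ℝ)).comp_left
      (g := fun L : E3 →L[ℝ] ℝ => L (EuclideanSpace.single i 1)) (by simp)
  have h := eLpNorm_le_eLpNorm_fderiv_of_eq (F := ℝ) (volume : Measure E3) (u := pd i f)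
    ((contDiff_pd hf i).of_le (by simp)) hcs (p := 2) (p' := 6) (by norm_num) (by simp)
    (by simp; norm_num)
  have h6 : ENNReal.ofReal 6 = ((6 : NNReal) : ENNReal) := by simp
  rw [h6]
  refine h.trans ?_
  gcongr
  refine eLpNorm_mono fun x => ?_
  rw [norm_norm]
  exact norm_fderiv_pd_le hf i x

/-- Lemma 2.2: anisotropic interpolation inequality
`‖f‖_{L^b} ≤ C ‖∂₃ f‖_{L^a}^s ‖∇² f‖_{L²}^{1-s}` for `f ∈ C₀^∞(ℝ³)`,
where `1/2 - 1/b = s`, `3(1/a - 1/2) = 2/s - 4`, `2 < b < ∞`, `1 ≤ a < 2`. -/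
theorem stmt_0 (s a b : ℝ) (hsb : 1 / 2 - 1 / b = s)
    (hsa : 3 * (1 / a - 1 / 2) = 2 / s - 4) (hb : 2 < b) (ha1 : 1 ≤ a) (ha2 : a < 2) :
    ∃ C : ℝ, 0 < C ∧ ∀ f : E3 → ℝ, ContDiff ℝ (⊤ : ℕ∞) f → HasCompactSupport f →
      eLpNorm f (ENNReal.ofReal b) volume ≤
        ENNReal.ofReal C *
          (eLpNorm (pd 2 f) (ENNReal.ofReal a) volume) ^ s *
          (eLpNorm (fun x => ‖iteratedFDeriv ℝ 2 f x‖) 2 volume) ^ (1 - s) := by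
  have ha0 : 0 < a := by linarith
  have hb0 : 0 < b := by linarith
  have hs0 : 0 < s := by
    rw [← hsb, sub_pos]
    exact one_div_lt_one_div_of_lt (by norm_num) hb
  have hs1 : s < 1 / 2 := by
    rw [← hsb]
    linarith [one_div_pos.mpr hb0]
  have hs2 : 1 / 4 < s := by
    have h1 : 1 / a ≤ 1 := by rw [div_le_one ha0]; exact ha1
    have h2 : 2 / s ≤ 11 / 2 := by linarith
    rw [div_le_iff₀ hs0] at h2
    linarith
  have hb4 : 4 < b := by
    have h : 1 / b < 1 / 4 := by linarith
    exact lt_of_one_div_lt_one_div hb0 h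
  have hr : 0 < 3 / 2 - 2 * s := by linarith
  have hbr : 1 / (1 / (3 / 2 - 2 * s)) = 1 / 2 + 2 / b := by
    rw [one_div_one_div, ← hsb]
    ring
  have hinter : 1 / (1 / (3 / 2 - 2 * s)) = 2 * s / a + (1 - 2 * s) / 6 := by
    have h1 : 1 / a = 1 / 2 + (2 / s - 4) / 3 := by linarith
    rw [one_div_one_div, div_eq_mul_one_div (2 * s) a, h1]
    field_simp
    ring
  obtain ⟨S, hS⟩ := exists_eLpNorm_pd_six_le
  set C₀ : ENNReal := (ENNReal.ofReal (b / 2) ^ 3) ^ (1 / 2 : ℝ) * (S : ENNReal) ^ (1 / 2 - s)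
  have hC₀ : C₀ ≠ ⊤ := ENNReal.mul_ne_top
    (ENNReal.rpow_ne_top_of_nonneg (by norm_num) (ENNReal.pow_ne_top ENNReal.ofReal_ne_top))
    (ENNReal.rpow_ne_top_of_nonneg (by linarith) ENNReal.coe_ne_top)
  refine ⟨C₀.toReal + 1, by positivity, fun f hf hc => ?_⟩
  have hC₀le : C₀ ≤ ENNReal.ofReal (C₀.toReal + 1) :=
    ENNReal.le_ofReal_iff_toReal_le hC₀ (by positivity) |>.mpr (by linarith)
  have h1 := eLpNorm_le_sqrt_mul_sqrt hf hc hb4 (one_div_pos.mpr hr) hbr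
  have h2 := eLpNorm_le_rpow_mul_rpow (μ := volume) (g := pd 2 f)
    (contDiff_pd hf 2).continuous.aestronglyMeasurable ha0 (by norm_num : (0 : ℝ) < 6)
    (one_div_pos.mpr hr) (by linarith) (by linarith) hinter
  have h3 := hS f hf hc 2
  set K := eLpNorm (fun x => ‖iteratedFDeriv ℝ 2 f x‖) 2 volume
  set A := eLpNorm (pd 2 f) (ENNReal.ofReal a) volume
  have hθ : 0 ≤ 1 - 2 * s := by linarith
  calc eLpNorm f (ENNReal.ofReal b) volume
      ≤ (ENNReal.ofReal (b / 2) ^ 3 * (A ^ (2 * s) * (S * K) ^ (1 - 2 * s) * K)) ^ (1 / 2 : ℝ) := by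
        refine h1.trans ?_
        gcongr
        refine h2.trans ?_
        gcongr
    _ = C₀ * A ^ s * K ^ (1 - s) := by
        have hhalf : (0 : ℝ) ≤ 1 / 2 := by norm_num
        rw [ENNReal.mul_rpow_of_nonneg _ _ hhalf, ENNReal.mul_rpow_of_nonneg _ _ hhalf,
          ENNReal.mul_rpow_of_nonneg _ _ hhalf, ENNReal.mul_rpow_of_nonneg _ _ hθ,
          ENNReal.mul_rpow_of_nonneg _ _ hhalf,
          ENNReal.rpow_rpow_of_mul_eq A (show 2 * s * (1 / 2) = s by ring),
          ENNReal.rpow_rpow_of_mul_eq K (show (1 - 2 * s) * (1 / 2) = 1 / 2 - s by ring),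
          ENNReal.rpow_rpow_of_mul_eq (S : ENNReal)
            (show (1 - 2 * s) * (1 / 2) = 1 / 2 - s by ring),
          show 1 - s = (1 / 2 - s) + 1 / 2 by ring,
          ENNReal.rpow_add_of_nonneg _ _ (by linarith) hhalf]
        ring
    _ ≤ _ := by gcongr
end
end

section
/- For every q with 1 ≤ q < ∞ there exists a constant C such that for all f ∈ C₀^∞(ℝ³), ‖f‖_{L^{3q}(ℝ³)} ≤ C ‖∂₃ f‖_{L^q(ℝ³)}^{1/3} ‖∇_h f‖_{L²(ℝ³)}^{2/3}, where ∇_h = (∂₁, ∂₂) is the horizontal gradient. -/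
open MeasureTheory

noncomputable section

/-- Pointwise norm of the horizontal gradient `∇_h f = (∂₁ f, ∂₂ f)`. -/
def gradH (f : E3 → ℝ) : E3 → ℝ :=
  fun x => Real.sqrt ((pd 0 f x) ^ 2 + (pd 1 f x) ^ 2)

/-- Fundamental theorem of calculus bound for a power of a compactly supported function. -/
lemma enorm_rpow_le_lintegral_deriv {u : ℝ → ℝ} (hu : ContDiff ℝ 1 u) (hsupp : HasCompactSupport u)
    {s : ℝ} (hs : 1 ≤ s) (t : ℝ) :
    ‖u t‖ₑ ^ s ≤ ENNReal.ofReal s * ∫⁻ y, ‖u y‖ₑ ^ (s - 1) * ‖deriv u y‖ₑ := by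
  rcases hs.eq_or_lt with rfl | hs
  · simpa using (HasCompactSupport.enorm_le_lintegral_Ici_deriv hu hsupp t).trans
      (lintegral_mono' Measure.restrict_le_self le_rfl)
  have hs0 : 0 < s := zero_lt_one.trans hs
  have hw : ContDiff ℝ 1 fun y ↦ ‖u y‖ ^ s := (contDiff_norm_rpow hs).comp hu
  have hwsupp : HasCompactSupport fun y ↦ ‖u y‖ ^ s :=
    hsupp.comp_left (g := fun z ↦ ‖z‖ ^ s) (by simp [hs0.ne'])
  have hderiv (y : ℝ) : deriv (fun y ↦ ‖u y‖ ^ s) y = s * ‖u y‖ ^ (s - 2) * u y * deriv u y :=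
    ((hasDerivAt_norm_rpow (u y) hs).comp y
      ((hu.differentiable one_ne_zero) y).hasDerivAt).deriv
  have hpow (y : ℝ) : ‖s * ‖u y‖ ^ (s - 2) * u y * deriv u y‖ₑ
      = ENNReal.ofReal s * (‖u y‖ₑ ^ (s - 1) * ‖deriv u y‖ₑ) := by
    have hnorm : ‖s * ‖u y‖ ^ (s - 2) * u y * deriv u y‖
        = s * (‖u y‖ ^ (s - 1) * ‖deriv u y‖) := by
      rw [norm_mul, norm_mul, norm_mul, Real.norm_of_nonneg hs0.le,
        Real.norm_of_nonneg (Real.rpow_nonneg (norm_nonneg _) _)]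
      rcases (norm_nonneg (u y)).eq_or_lt with h | h
      · simp [← h, Real.zero_rpow (sub_pos.2 hs).ne']
      · rw [show s - 1 = s - 2 + 1 by ring, Real.rpow_add_one h.ne']
        ring
    rw [← ofReal_norm, hnorm, ENNReal.ofReal_mul hs0.le,
      ENNReal.ofReal_mul (Real.rpow_nonneg (norm_nonneg _) _),
      ← ENNReal.ofReal_rpow_of_nonneg (norm_nonneg _) (sub_pos.2 hs).le, ofReal_norm,
      ofReal_norm]
  calc ‖u t‖ₑ ^ s = ‖‖u t‖ ^ s‖ₑ := by
        rw [Real.enorm_rpow_of_nonneg (norm_nonneg _) hs0.le, enorm_norm]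
    _ ≤ ∫⁻ y, ‖deriv (fun y ↦ ‖u y‖ ^ s) y‖ₑ :=
        (HasCompactSupport.enorm_le_lintegral_Ici_deriv hw hwsupp t).trans
          (lintegral_mono' Measure.restrict_le_self le_rfl)
    _ = ENNReal.ofReal s * ∫⁻ y, ‖u y‖ₑ ^ (s - 1) * ‖deriv u y‖ₑ := by
        simp_rw [hderiv, hpow]
        rw [lintegral_const_mul' _ _ ENNReal.ofReal_ne_top]

/-- A Loomis–Whitney inequality on `ℝ³` with three different functions. -/
lemma lintegral_prod_lintegral_update_rpow_le {F : Fin 3 → (Fin 3 → ℝ) → ENNReal}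
    (hF : ∀ i, Measurable (F i)) {A : Fin 3 → ENNReal} (hA0 : ∀ i, A i ≠ 0) (hA : ∀ i, A i ≠ ⊤)
    (hFA : ∀ i, ∫⁻ x, F i x ≤ A i) :
    ∫⁻ x, ∏ i, (∫⁻ t, F i (Function.update x i t)) ^ ((1 : ℝ) / 2)
      ≤ (27 * ∏ i, A i) ^ ((1 : ℝ) / 2) := by
  have hprod0 : ∏ i, A i ≠ 0 := Finset.prod_ne_zero_iff.2 fun i _ ↦ hA0 i
  have hprod : ∏ i, A i ≠ ⊤ := ENNReal.prod_ne_top fun i _ ↦ hA i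
  set f : (Fin 3 → ℝ) → ENNReal := fun x ↦ ∑ i, (A i)⁻¹ * F i x
  have hf : Measurable f := Finset.measurable_fun_sum _ fun i _ ↦ (hF i).const_mul _
  have hf_int : ∫⁻ x, f x ≤ 3 := by
    rw [lintegral_finsetSum _ fun i _ ↦ (hF i).const_mul _]
    calc ∑ i, ∫⁻ x, (A i)⁻¹ * F i x ≤ ∑ _i : Fin 3, 1 := by
          gcongr with i
          rw [lintegral_const_mul _ (hF i)]
          exact (mul_le_mul_right (hFA i) _).trans (ENNReal.inv_mul_cancel (hA0 i) (hA i)).le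
      _ = 3 := by simp
  have hgrid := lintegral_mul_prod_lintegral_pow_le (fun _ : Fin 3 ↦ (volume : Measure ℝ))
    (p := 1 / 2) (by norm_num) (by norm_num) hf
  have hpow : (27 : ENNReal) ^ ((1 : ℝ) / 2) = 3 ^ (1 + (1 : ℝ) / 2) := by
    rw [show (27 : ENNReal) = 3 ^ (3 : ℝ) by norm_num, ← ENNReal.rpow_mul]
    norm_num
  have hscale : ((∏ i, A i)⁻¹) ^ ((1 : ℝ) / 2) *
      ∫⁻ x, ∏ i, (∫⁻ t, F i (Function.update x i t)) ^ ((1 : ℝ) / 2) ≤ 3 ^ (1 + (1 : ℝ) / 2) := by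
    rw [← lintegral_const_mul' _ _
      (ENNReal.rpow_ne_top_of_nonneg (by norm_num) (ENNReal.inv_ne_top.2 hprod0))]
    refine le_trans (lintegral_mono fun x ↦ ?_)
      (hgrid.trans (ENNReal.rpow_le_rpow hf_int (by norm_num)))
    have h0 : (1 : ℝ) - ((Fintype.card (Fin 3) : ℝ) - 1) * (1 / 2) = 0 := by norm_num
    rw [h0, ENNReal.rpow_zero, one_mul, ENNReal.prod_inv_distrib
      (fun i _ j _ _ ↦ Or.inl (hA0 i)), ← ENNReal.prod_rpow_of_nonneg (by norm_num),
      ← Finset.prod_mul_distrib]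
    gcongr with i
    rw [← ENNReal.mul_rpow_of_nonneg _ _ (by norm_num : (0 : ℝ) ≤ 1 / 2),
      ← lintegral_const_mul' _ _ (ENNReal.inv_ne_top.2 (hA0 i))]
    gcongr with t
    exact Finset.single_le_sum (f := fun j ↦ (A j)⁻¹ * F j (Function.update x i t))
      (fun _ _ ↦ zero_le) (Finset.mem_univ i)
  rw [ENNReal.mul_rpow_of_nonneg _ _ (by norm_num), hpow, mul_comm]
  rwa [ENNReal.inv_rpow, ENNReal.inv_mul_le_iff] at hscale
  · simp [hprod0, hprod]
  · exact ENNReal.rpow_ne_top_of_nonneg (by norm_num) hprod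

lemma eLpNorm_ofReal_rpow {α : Type*} [MeasurableSpace α] {μ : Measure α} {g : α → ℝ} {r : ℝ}
    (hr : 0 < r) : eLpNorm g (ENNReal.ofReal r) μ ^ r = ∫⁻ x, ‖g x‖ₑ ^ r ∂μ := by
  rw [eLpNorm_eq_lintegral_rpow_enorm_toReal (by simpa using hr) ENNReal.ofReal_ne_top,
    ENNReal.toReal_ofReal hr.le, ← ENNReal.rpow_mul, one_div_mul_cancel hr.ne', ENNReal.rpow_one]

/-- Hölder's inequality for a power of `g` against `h`. -/
lemma lintegral_enorm_rpow_mul_le {α : Type*} [MeasurableSpace α] {μ : Measure α} {g h : α → ℝ}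
    (hg : AEMeasurable g μ) (hh : AEMeasurable h μ) {m r : ℝ} (hm : 0 < m) (hr : 1 ≤ r) :
    ∫⁻ x, ‖g x‖ₑ ^ (m * (1 - 1 / r)) * ‖h x‖ₑ ∂μ
      ≤ eLpNorm g (ENNReal.ofReal m) μ ^ (m * (1 - 1 / r)) * eLpNorm h (ENNReal.ofReal r) μ := by
  have hr0 : 0 < r := zero_lt_one.trans_le hr
  have hr1 : 0 ≤ 1 - 1 / r := sub_nonneg.2 ((div_le_one hr0).2 hr)
  have key := ENNReal.lintegral_mul_norm_pow_le (hg.enorm.pow_const m) (hh.enorm.pow_const r)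
    hr1 (by positivity : 0 ≤ 1 / r) (by ring)
  simpa only [← eLpNorm_ofReal_rpow hm, ← eLpNorm_ofReal_rpow hr0, ← ENNReal.rpow_mul,
    mul_one_div_cancel hr0.ne', ENNReal.rpow_one] using key

lemma enorm_rpow_le_lintegral_fderiv_update {g : (Fin 3 → ℝ) → ℝ} (hg : ContDiff ℝ 1 g)
    (hsupp : HasCompactSupport g) {s : ℝ} (hs : 1 ≤ s) (i : Fin 3) (x : Fin 3 → ℝ) :
    ‖g x‖ₑ ^ s ≤ ∫⁻ t, ENNReal.ofReal s * (‖g (Function.update x i t)‖ₑ ^ (s - 1) *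
      ‖fderiv ℝ g (Function.update x i t) (Pi.single i 1)‖ₑ) := by
  have hu : ContDiff ℝ 1 (g ∘ Function.update x i) := hg.comp (by convert! contDiff_update 1 x i)
  have husupp : HasCompactSupport (g ∘ Function.update x i) :=
    hsupp.comp_isClosedEmbedding (isClosedEmbedding_update x i)
  have hderiv (t : ℝ) : deriv (g ∘ Function.update x i) t
      = fderiv ℝ g (Function.update x i t) (Pi.single i 1) :=
    (((hg.differentiable one_ne_zero) _).hasFDerivAt.comp_hasDerivAt t
      (hasDerivAt_update x i t)).deriv
  have key := enorm_rpow_le_lintegral_deriv hu husupp hs (x i)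
  rw [lintegral_const_mul' _ _ ENNReal.ofReal_ne_top]
  simpa [hderiv] using key

/-- Anisotropic Gagliardo–Nirenberg–Sobolev inequality on `ℝ³`, with its own Lebesgue exponent `r i ≥ 1`
for each partial derivative; `hmr` is the scaling relation. -/
lemma eLpNorm_le_prod_eLpNorm_fderiv {g : (Fin 3 → ℝ) → ℝ} (hg : ContDiff ℝ 1 g)
    (hsupp : HasCompactSupport g) {m : ℝ} (hm : 0 < m) {r : Fin 3 → ℝ} (hr : ∀ i, 1 ≤ r i)
    (hmr : m * (∑ i, 1 / r i - 1) = 3) :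
    eLpNorm g (ENNReal.ofReal m) volume ≤
      (27 * ∏ i, (ENNReal.ofReal (m * (1 - 1 / r i) + 1) *
        eLpNorm (fun x ↦ fderiv ℝ g x (Pi.single i 1)) (ENNReal.ofReal (r i)) volume))
        ^ ((1 : ℝ) / 3) := by
  set n := eLpNorm g (ENNReal.ofReal m) volume with hn_def
  set D : Fin 3 → ENNReal := fun i ↦
    eLpNorm (fun x ↦ fderiv ℝ g x (Pi.single i 1)) (ENNReal.ofReal (r i)) volume with hD_def
  set a : Fin 3 → ℝ := fun i ↦ m * (1 - 1 / r i) with ha_def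
  change n ≤ (27 * ∏ i, (ENNReal.ofReal (a i + 1) * D i)) ^ ((1 : ℝ) / 3)
  have hr0 (i) : 0 < r i := zero_lt_one.trans_le (hr i)
  have ha (i) : 0 ≤ a i := mul_nonneg hm.le (sub_nonneg.2 ((div_le_one (hr0 i)).2 (hr i)))
  have hG (i) : Continuous fun x ↦ fderiv ℝ g x (Pi.single i 1) :=
    (hg.continuous_fderiv one_ne_zero).clm_apply continuous_const
  have hGsupp (i) : HasCompactSupport fun x ↦ fderiv ℝ g x (Pi.single i 1) :=
    hsupp.fderiv_apply ℝ _
  have hn : n ≠ ⊤ := (hg.continuous.memLp_of_hasCompactSupport hsupp).eLpNorm_ne_top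
  have hD (i) : D i ≠ ⊤ := ((hG i).memLp_of_hasCompactSupport (hGsupp i)).eLpNorm_ne_top
  rcases eq_or_ne n 0 with hn0 | hn0
  · simp [hn0]
  have hD0 (i) : D i ≠ 0 := by
    intro h
    rw [hD_def, eLpNorm_eq_zero_iff (hG i).aestronglyMeasurable (by simpa using hr0 i),
      (hG i).ae_eq_iff_eq volume continuous_zero] at h
    refine hn0 ?_
    have hg0 : g = 0 := by
      ext x
      have := enorm_rpow_le_lintegral_fderiv_update hg hsupp le_rfl i x
      simpa [fun y ↦ congrFun h y] using this
    simp [hn_def, hg0]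
  have hsum : ∑ i, (a i + 1) = 2 * m := by
    simp only [ha_def, Fin.sum_univ_three] at hmr ⊢
    linarith
  have hexp : m = ∑ i, a i * (1 / 2) + 3 / 2 := by
    simp only [Fin.sum_univ_three] at hsum ⊢
    linarith
  have hmain : n ^ m ≤
      (27 * ∏ i, (ENNReal.ofReal (a i + 1) * (n ^ a i * D i))) ^ ((1 : ℝ) / 2) := by
    rw [show n ^ m = ∫⁻ x, ‖g x‖ₑ ^ m from eLpNorm_ofReal_rpow hm]
    calc ∫⁻ x, ‖g x‖ₑ ^ m
        = ∫⁻ x, ∏ i, (‖g x‖ₑ ^ (a i + 1)) ^ ((1 : ℝ) / 2) := by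
          congr! 2 with x
          simp_rw [← ENNReal.rpow_mul]
          rw [Fin.prod_univ_three, ← ENNReal.rpow_add_of_nonneg, ← ENNReal.rpow_add_of_nonneg]
          · congr 1
            rw [Fin.sum_univ_three] at hsum
            linarith
          all_goals linarith [ha 0, ha 1, ha 2]
      _ ≤ ∫⁻ x, ∏ i, (∫⁻ t, ENNReal.ofReal (a i + 1) * (‖g (Function.update x i t)‖ₑ ^ a i *
            ‖fderiv ℝ g (Function.update x i t) (Pi.single i 1)‖ₑ)) ^ ((1 : ℝ) / 2) := by
          gcongr with x i
          simpa using enorm_rpow_le_lintegral_fderiv_update hg hsupp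
            (le_add_of_nonneg_left (ha i)) i x
      _ ≤ _ := by
          refine lintegral_prod_lintegral_update_rpow_le
            (F := fun i x ↦ ENNReal.ofReal (a i + 1) *
              (‖g x‖ₑ ^ a i * ‖fderiv ℝ g x (Pi.single i 1)‖ₑ)) (fun i ↦ ?_) (fun i ↦ ?_)
            (fun i ↦ ?_) fun i ↦ ?_
          · exact ((hg.continuous.measurable.enorm.pow_const _).mul
              (hG i).measurable.enorm).const_mul _
          · exact mul_ne_zero (by simpa using add_pos_of_nonneg_of_pos (ha i) one_pos)
              (mul_ne_zero (ENNReal.rpow_pos (pos_iff_ne_zero.2 hn0) hn).ne' (hD0 i))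
          · exact ENNReal.mul_ne_top ENNReal.ofReal_ne_top
              (ENNReal.mul_ne_top (ENNReal.rpow_ne_top_of_nonneg (ha i) hn) (hD i))
          · rw [lintegral_const_mul' _ _ ENNReal.ofReal_ne_top]
            gcongr
            exact lintegral_enorm_rpow_mul_le hg.continuous.aemeasurable (hG i).aemeasurable
              hm (hr i)
  set P := 27 * ∏ i, (ENNReal.ofReal (a i + 1) * D i) with hP_def
  have hfactor : 27 * ∏ i, (ENNReal.ofReal (a i + 1) * (n ^ a i * D i))
      = n ^ (∑ i, a i) * P := by
    rw [hP_def, Fin.sum_univ_three, ENNReal.rpow_add _ _ hn0 hn, ENNReal.rpow_add _ _ hn0 hn]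
    simp only [Fin.prod_univ_three]
    ring
  rw [hfactor, ENNReal.mul_rpow_of_nonneg _ _ (by norm_num), ← ENNReal.rpow_mul, Finset.sum_mul,
    hexp, ENNReal.rpow_add _ _ hn0 hn,
    ENNReal.mul_le_mul_iff_right (by simp [hn0, hn]) (ENNReal.rpow_ne_top_of_ne_zero hn0 hn)]
    at hmain
  have := ENNReal.rpow_le_rpow hmain (by norm_num : (0 : ℝ) ≤ 2 / 3)
  rw [← ENNReal.rpow_mul, ← ENNReal.rpow_mul] at this
  norm_num at this ⊢
  exact this

lemma eLpNorm_comp_toLp {h : E3 → ℝ} (hh : Continuous h) (p : ENNReal) :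
    eLpNorm (fun y : Fin 3 → ℝ ↦ h (WithLp.toLp 2 y)) p volume = eLpNorm h p volume :=
  eLpNorm_comp_measurePreserving hh.aestronglyMeasurable (PiLp.volume_preserving_toLp (Fin 3))

/-- `‖f‖_{L^{3q}} ≤ C ‖∂₃ f‖_{L^q}^{1/3} ‖∇_h f‖_{L²}^{2/3}` for `f ∈ C₀^∞(ℝ³)`, `1 ≤ q < ∞`. -/
theorem stmt_1 (q : ℝ) (hq1 : 1 ≤ q) :
    ∃ C : ℝ, 0 < C ∧ ∀ f : E3 → ℝ, ContDiff ℝ (⊤ : ℕ∞) f → HasCompactSupport f →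
      eLpNorm f (ENNReal.ofReal (3 * q)) volume ≤
        ENNReal.ofReal C *
          (eLpNorm (pd 2 f) (ENNReal.ofReal q) volume) ^ ((1 : ℝ) / 3) *
          (eLpNorm (gradH f) 2 volume) ^ ((2 : ℝ) / 3) := by
  have hq0 : 0 < q := zero_lt_one.trans_le hq1
  set r : Fin 3 → ℝ := ![2, 2, q] with hr_def
  have hr (i) : 1 ≤ r i := by
    fin_cases i <;> simp [hr_def, hq1]
  have hs (i) : 0 < 3 * q * (1 - 1 / r i) + 1 := by
    have : 1 / r i ≤ 1 := (div_le_one (zero_lt_one.trans_le (hr i))).2 (hr i)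
    nlinarith
  set K : ℝ := 27 * ∏ i, (3 * q * (1 - 1 / r i) + 1) with hK_def
  have hK : 0 < K := mul_pos (by norm_num) (Finset.prod_pos fun i _ ↦ hs i)
  refine ⟨K ^ ((1 : ℝ) / 3), Real.rpow_pos_of_pos hK _, fun f hf hsupp ↦ ?_⟩
  set L := (PiLp.continuousLinearEquiv 2 ℝ (fun _ : Fin 3 ↦ ℝ)).symm
  have hf1 : ContDiff ℝ 1 f := hf.of_le (by exact_mod_cast le_top)
  have hpd (i : Fin 3) : Continuous (pd i f) :=
    (hf1.continuous_fderiv one_ne_zero).clm_apply continuous_const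
  have hfderiv (i : Fin 3) (y : Fin 3 → ℝ) :
      fderiv ℝ (fun y ↦ f (L y)) y (Pi.single i 1) = pd i f (WithLp.toLp 2 y) := by
    have h := (((hf1.differentiable one_ne_zero) (L y)).hasFDerivAt.comp y L.hasFDerivAt).fderiv
    exact congrArg (fun T : (Fin 3 → ℝ) →L[ℝ] ℝ ↦ T (Pi.single i 1)) h
  have key := eLpNorm_le_prod_eLpNorm_fderiv (g := fun y ↦ f (L y)) (hf1.comp L.contDiff)
    (hsupp.comp_homeomorph L.toHomeomorph) (m := 3 * q) (by positivity) hr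
    (by simp [hr_def, Fin.sum_univ_three]; field_simp; ring)
  simp_rw [hfderiv, eLpNorm_comp_toLp (hpd _)] at key
  rw [show eLpNorm (fun y ↦ f (L y)) (ENNReal.ofReal (3 * q)) volume
    = eLpNorm f (ENNReal.ofReal (3 * q)) volume from eLpNorm_comp_toLp hf1.continuous _,
    Finset.prod_mul_distrib, ← mul_assoc, ← ENNReal.ofReal_prod_of_nonneg fun i _ ↦ (hs i).le,
    show (27 : ENNReal) = ENNReal.ofReal 27 by simp, ← ENNReal.ofReal_mul (by norm_num),
    ← hK_def, ENNReal.mul_rpow_of_nonneg _ _ (by norm_num),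
    ENNReal.ofReal_rpow_of_nonneg hK.le (by norm_num)] at key
  refine key.trans ?_
  rw [mul_assoc]
  gcongr
  have h0 : eLpNorm (pd 0 f) 2 volume ≤ eLpNorm (gradH f) 2 volume :=
    eLpNorm_mono fun x ↦ by
      rw [gradH, Real.norm_of_nonneg (Real.sqrt_nonneg _), Real.norm_eq_abs]
      exact Real.abs_le_sqrt (le_add_of_nonneg_right (sq_nonneg _))
  have h1 : eLpNorm (pd 1 f) 2 volume ≤ eLpNorm (gradH f) 2 volume :=
    eLpNorm_mono fun x ↦ by
      rw [gradH, Real.norm_of_nonneg (Real.sqrt_nonneg _), Real.norm_eq_abs]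
      exact Real.abs_le_sqrt (le_add_of_nonneg_left (sq_nonneg _))
  calc (∏ i, eLpNorm (pd i f) (ENNReal.ofReal (r i)) volume) ^ ((1 : ℝ) / 3)
      ≤ (eLpNorm (gradH f) 2 volume ^ (2 : ℝ) *
          eLpNorm (pd 2 f) (ENNReal.ofReal q) volume) ^ ((1 : ℝ) / 3) := by
        gcongr
        rw [Fin.prod_univ_three, ENNReal.rpow_two, sq]
        simp only [hr_def, Matrix.cons_val, ENNReal.ofReal_ofNat]
        gcongr
    _ = _ := by
        rw [ENNReal.mul_rpow_of_nonneg _ _ (by norm_num), ← ENNReal.rpow_mul, mul_comm]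
        norm_num
end
end

section
/- Let 1 < r < ∞ and let u be a smooth divergence-free vector field on ℝ³ with suitable decay. With ω³ = ∂₁u² − ∂₂u¹ and u^h = (u¹, u²), there is a constant C = C(r) with ‖∇u^h‖_{L^r(ℝ³)} ≤ C( ‖∂₃ u‖_{L^r(ℝ³)} + ‖ω³‖_{L^r(ℝ³)} ). -/
open MeasureTheory

noncomputable section

section Profile

/-- A convex function of linear growth on the plane that vanishes near the origin. -/
def profile (x y : ℝ) : ℝ := max (√(1 + x ^ 2 + y ^ 2) - 2) 0

lemma profile_nonneg (x y : ℝ) : 0 ≤ profile x y := le_max_right _ _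

lemma continuous_profile : Continuous fun z : ℝ × ℝ => profile z.1 z.2 := by
  unfold profile; fun_prop

lemma profile_le (x y : ℝ) : profile x y ≤ |x| + |y| := by
  refine max_le ?_ (by positivity)
  have : √(1 + x ^ 2 + y ^ 2) ≤ 1 + |x| + |y| := by
    refine Real.sqrt_le_iff.2 ⟨by positivity, ?_⟩
    nlinarith [sq_abs x, sq_abs y, abs_nonneg x, abs_nonneg y,
      mul_nonneg (abs_nonneg x) (abs_nonneg y)]
  linarith

lemma profile_eq_zero {x y : ℝ} (hx : |x| ≤ 1) (hy : |y| ≤ 1) : profile x y = 0 := by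
  refine max_eq_right ?_
  have : √(1 + x ^ 2 + y ^ 2) ≤ 2 := by
    refine Real.sqrt_le_iff.2 ⟨by norm_num, ?_⟩
    nlinarith [(sq_le_one_iff_abs_le_one x).2 hx, (sq_le_one_iff_abs_le_one y).2 hy]
  linarith

lemma card_mul_profile_average_le {ι : Type*} [Fintype ι] [Nonempty ι] (x y : ι → ℝ) :
    (Fintype.card ι : ℝ) *
        profile ((∑ k, x k) / Fintype.card ι) ((∑ k, y k) / Fintype.card ι) ≤
      ∑ k, profile (x k) (y k) := by
  set N : ℝ := ((Fintype.card ι : ℕ) : ℝ) with hN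
  have hNpos : 0 < N := by rw [hN]; exact_mod_cast Fintype.card_pos
  set X := (∑ k, x k) / N with hX
  set Y := (∑ k, y k) / N with hY
  set m := √(1 + X ^ 2 + Y ^ 2) with hm
  have hm2 : m ^ 2 = 1 + X ^ 2 + Y ^ 2 := Real.sq_sqrt (by positivity)
  have hmpos : 0 < m := Real.sqrt_pos.2 (by positivity)
  have key : ∀ k, 1 + X * x k + Y * y k ≤ m * √(1 + x k ^ 2 + y k ^ 2) := by
    intro k
    rw [hm, ← Real.sqrt_mul (by positivity)]
    apply Real.le_sqrt_of_sq_le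
    nlinarith [sq_nonneg (X - x k), sq_nonneg (Y - y k), sq_nonneg (X * y k - Y * x k)]
  have hsum : N * m ≤ ∑ k, √(1 + x k ^ 2 + y k ^ 2) := by
    have h := Finset.sum_le_sum fun k (_ : k ∈ Finset.univ) => key k
    rw [← Finset.mul_sum, Finset.sum_add_distrib, Finset.sum_add_distrib, ← Finset.mul_sum,
      ← Finset.mul_sum] at h
    have hx : ∑ k, x k = N * X := by rw [hX]; field_simp
    have hy : ∑ k, y k = N * Y := by rw [hY]; field_simp
    have h1 : ∑ _k : ι, (1 : ℝ) = N := by simp [hN]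
    rw [hx, hy, h1] at h
    have : m * (N * m) ≤ m * ∑ k, √(1 + x k ^ 2 + y k ^ 2) := by nlinarith
    exact le_of_mul_le_mul_left this hmpos
  rw [profile, mul_max_of_nonneg _ _ hNpos.le, mul_zero]
  refine max_le ?_ (Finset.sum_nonneg fun k _ => profile_nonneg _ _)
  calc N * (m - 2) ≤ ∑ k, (√(1 + x k ^ 2 + y k ^ 2) - 2) := by
        rw [Finset.sum_sub_distrib]
        simp only [Finset.sum_const, Finset.card_univ, nsmul_eq_mul, ← hN]
        linarith
    _ ≤ _ := Finset.sum_le_sum fun k _ => le_max_left _ _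

lemma two_mul_profile_midpoint_le (x y x' y' : ℝ) :
    2 * profile ((x + x') / 2) ((y + y') / 2) ≤ profile x y + profile x' y' := by
  simpa using card_mul_profile_average_le ![x, x'] ![y, y']

lemma two_mul_sqrt_midpoint_add_le {R x y x' y' : ℝ} (hx : |x| ≤ R) (hy : |y| ≤ R)
    (hx' : |x'| ≤ R) (hy' : |y'| ≤ R) :
    2 * √(1 + ((x + x') / 2) ^ 2 + ((y + y') / 2) ^ 2) +
        (|x - x'| * |y - y'|) / (2 * (1 + 2 * R) ^ 3) ≤
      √(1 + x ^ 2 + y ^ 2) + √(1 + x' ^ 2 + y' ^ 2) := by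
  have hR : 0 ≤ R := (abs_nonneg x).trans hx
  have bound : ∀ {s t : ℝ}, |s| ≤ R → |t| ≤ R → √(1 + s ^ 2 + t ^ 2) ≤ 1 + 2 * R := by
    intro s t hs ht
    refine Real.sqrt_le_iff.2 ⟨by positivity, ?_⟩
    nlinarith [sq_abs s, sq_abs t, abs_nonneg s, abs_nonneg t]
  have hxR : |(x + x') / 2| ≤ R := by
    rw [abs_le] at *; constructor <;> linarith
  have hyR : |(y + y') / 2| ≤ R := by
    rw [abs_le] at *; constructor <;> linarith
  have ha := bound hx hy
  have hb := bound hx' hy'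
  have hc := bound hxR hyR
  have ha2 : √(1 + x ^ 2 + y ^ 2) ^ 2 = 1 + x ^ 2 + y ^ 2 := Real.sq_sqrt (by positivity)
  have hb2 : √(1 + x' ^ 2 + y' ^ 2) ^ 2 = 1 + x' ^ 2 + y' ^ 2 := Real.sq_sqrt (by positivity)
  have hc2 : √(1 + ((x + x') / 2) ^ 2 + ((y + y') / 2) ^ 2) ^ 2 =
    1 + ((x + x') / 2) ^ 2 + ((y + y') / 2) ^ 2 := Real.sq_sqrt (by positivity)
  have ha0 := Real.one_le_sqrt.2 (show 1 ≤ 1 + x ^ 2 + y ^ 2 by nlinarith)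
  have hb0 := Real.one_le_sqrt.2 (show 1 ≤ 1 + x' ^ 2 + y' ^ 2 by nlinarith)
  have hc0 := Real.one_le_sqrt.2
    (show 1 ≤ 1 + ((x + x') / 2) ^ 2 + ((y + y') / 2) ^ 2 by nlinarith)
  set a := √(1 + x ^ 2 + y ^ 2)
  set b := √(1 + x' ^ 2 + y' ^ 2)
  set c := √(1 + ((x + x') / 2) ^ 2 + ((y + y') / 2) ^ 2)
  set S := 1 + 2 * R with hS
  have hS1 : 1 ≤ S := by linarith
  set D := (x - x') ^ 2 + (y - y') ^ 2 with hD
  have hD0 : 0 ≤ D := by positivity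
  have hDle : 2 * (|x - x'| * |y - y'|) ≤ D := by
    nlinarith [sq_nonneg (|x - x'| - |y - y'|), sq_abs (x - x'), sq_abs (y - y')]
  have hab : a * b ≤ S ^ 2 := by nlinarith
  have hab1 : 1 ≤ a * b := by nlinarith
  set t := 1 + x * x' + y * y' with ht
  have h1 : D ≤ (a * b) ^ 2 - t ^ 2 := by
    rw [mul_pow, ha2, hb2]
    nlinarith [sq_nonneg (x * y' - y * x')]
  have htab : |t| ≤ a * b := abs_le_of_sq_le_sq (by linarith) (by linarith)
  have h2 : D ≤ (a * b - t) * (2 * S ^ 2) := by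
    have := abs_le.1 htab
    calc D ≤ (a * b - t) * (a * b + t) := by linarith
      _ ≤ _ := by gcongr <;> linarith
  have h3 : (a + b) ^ 2 - (2 * c) ^ 2 = 2 * (a * b - t) := by
    have : (a + b) ^ 2 - (2 * c) ^ 2 = a ^ 2 + b ^ 2 + 2 * (a * b) - 4 * c ^ 2 := by ring
    rw [this, ha2, hb2, hc2, ht]; ring
  have hge : 2 * c ≤ a + b := by
    refine (pow_le_pow_iff_left₀ (by positivity) (by positivity) two_ne_zero).1 ?_
    have : 0 ≤ a * b - t := by linarith [(abs_le.1 htab).2]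
    linarith
  have h4 : D ≤ (a + b - 2 * c) * (4 * S ^ 3) := by
    have : 2 * (a * b - t) ≤ (a + b - 2 * c) * (4 * S) := by
      rw [← h3]
      calc (a + b) ^ 2 - (2 * c) ^ 2 = (a + b - 2 * c) * (a + b + 2 * c) := by ring
        _ ≤ _ := by gcongr; linarith
    calc D ≤ (2 * (a * b - t)) * S ^ 2 := by linarith
      _ ≤ ((a + b - 2 * c) * (4 * S)) * S ^ 2 := by gcongr
      _ = _ := by ring
  have : |x - x'| * |y - y'| / (2 * S ^ 3) ≤ a + b - 2 * c := by
    rw [div_le_iff₀ (by positivity)]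
    linarith
  linarith

lemma two_mul_profile_midpoint_add_le {R x y x' y' : ℝ} (hx : |x| ≤ R) (hy : |y| ≤ R)
    (hx' : |x'| ≤ R) (hy' : |y'| ≤ R) (h : 9 ≤ x ^ 2 + y ^ 2 ∨ 9 ≤ x' ^ 2 + y' ^ 2) :
    2 * profile ((x + x') / 2) ((y + y') / 2) +
        (|x - x'| * |y - y'|) / (2 * (1 + 2 * R) ^ 3) ≤
      profile x y + profile x' y' := by
  have hR : 0 ≤ R := (abs_nonneg x).trans hx
  rcases le_total 2 (√(1 + ((x + x') / 2) ^ 2 + ((y + y') / 2) ^ 2)) with hm | hm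
  · have h1 := two_mul_sqrt_midpoint_add_le hx hy hx' hy'
    have h2 : profile ((x + x') / 2) ((y + y') / 2) = _ := max_eq_left (sub_nonneg.2 hm)
    have h3 : _ ≤ profile x y := le_max_left _ _
    have h4 : _ ≤ profile x' y' := le_max_left _ _
    linarith
  · have h2 : profile ((x + x') / 2) ((y + y') / 2) = 0 := max_eq_right (sub_nonpos.2 hm)
    have large : ∀ {s t : ℝ}, 9 ≤ s ^ 2 + t ^ 2 → 1 ≤ profile s t := by
      intro s t hst
      have : 3 ≤ √(1 + s ^ 2 + t ^ 2) := Real.le_sqrt_of_sq_le (by linarith)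
      exact le_max_of_le_left (by linarith)
    have h1 : 1 ≤ profile x y + profile x' y' := by
      rcases h with h | h
      · linarith [large h, profile_nonneg x' y']
      · linarith [large h, profile_nonneg x y]
    have h3 : |x - x'| * |y - y'| ≤ (2 * R) * (2 * R) := by
      have e1 : |x - x'| ≤ 2 * R := by
        rw [abs_le] at *; constructor <;> linarith
      have e2 : |y - y'| ≤ 2 * R := by
        rw [abs_le] at *; constructor <;> linarith
      gcongr
    have h4 : |x - x'| * |y - y'| / (2 * (1 + 2 * R) ^ 3) ≤ 1 := by
      rw [div_le_one (by positivity)]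
      nlinarith [pow_nonneg hR 3, pow_nonneg hR 2]
    rw [h2]; linarith

end Profile

section Bellman

/-- The superposition over all scales `l` of the functions `profile` adapted to the box
`|x| ≤ l ^ (1 / p)`, `|y| ≤ l ^ (1 / q)`. -/
def bellman (p q x y : ℝ) : ENNReal :=
  ∫⁻ l in Set.Ioi (0 : ℝ), ENNReal.ofReal (profile (x * l ^ (-p⁻¹)) (y * l ^ (-q⁻¹)))

lemma measurable_scaled_profile (p q : ℝ) :
    Measurable fun z : (ℝ × ℝ) × ℝ =>
      ENNReal.ofReal (profile (z.1.1 * z.2 ^ (-p⁻¹)) (z.1.2 * z.2 ^ (-q⁻¹))) := by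
  have h : Measurable fun z : (ℝ × ℝ) × ℝ => (z.1.1 * z.2 ^ (-p⁻¹), z.1.2 * z.2 ^ (-q⁻¹)) :=
    (measurable_fst.fst.mul (measurable_snd.pow_const _)).prodMk
      (measurable_fst.snd.mul (measurable_snd.pow_const _))
  exact (continuous_profile.measurable.comp h).ennreal_ofReal

lemma measurable_bellman (p q : ℝ) : Measurable fun z : ℝ × ℝ => bellman p q z.1 z.2 :=
  (measurable_scaled_profile p q).lintegral_prod_right'

lemma Measurable.bellman {α : Type*} [MeasurableSpace α] (p q : ℝ) {f g : α → ℝ}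
    (hf : Measurable f) (hg : Measurable g) : Measurable fun x => bellman p q (f x) (g x) := by
  have h := (measurable_bellman p q).comp (hf.prodMk hg)
  simpa only [Function.comp_def] using h

lemma measurable_scaled_profile_right (p q x y : ℝ) :
    Measurable fun l : ℝ =>
      ENNReal.ofReal (profile (x * l ^ (-p⁻¹)) (y * l ^ (-q⁻¹))) := by
  have h : Measurable fun l : ℝ => (x * l ^ (-p⁻¹), y * l ^ (-q⁻¹)) :=
    ((measurable_id.pow_const _).const_mul _).prodMk ((measurable_id.pow_const _).const_mul _)
  exact (continuous_profile.measurable.comp h).ennreal_ofReal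

lemma setIntegral_rpow_neg_inv {p q : ℝ} (hpq : p.HolderConjugate q) {L : ℝ} (hL : 0 ≤ L) :
    IntegrableOn (fun l : ℝ => l ^ (-p⁻¹)) (Set.Ioc 0 L) ∧
      ∫ l in Set.Ioc 0 L, l ^ (-p⁻¹) = q * L ^ q⁻¹ := by
  have h1 : -1 < -p⁻¹ := neg_lt_neg (inv_lt_one_of_one_lt₀ hpq.lt)
  have h2 : -p⁻¹ + 1 = q⁻¹ := by linarith [hpq.inv_add_inv_eq_one]
  refine ⟨(intervalIntegrable_iff_integrableOn_Ioc_of_le hL).1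
    (intervalIntegral.intervalIntegrable_rpow' h1), ?_⟩
  rw [← intervalIntegral.integral_of_le hL, integral_rpow (Or.inl h1), h2,
    Real.zero_rpow (inv_ne_zero hpq.symm.ne_zero), sub_zero, div_inv_eq_mul, mul_comm]

lemma bellman_le {p q : ℝ} (hpq : p.HolderConjugate q) (x y : ℝ) :
    bellman p q x y ≤ ENNReal.ofReal ((p + q) * (|x| ^ p + |y| ^ q)) := by
  have hp := hpq.pos
  have hq := hpq.symm.pos
  set L := |x| ^ p + |y| ^ q with hL
  have hL0 : 0 ≤ L := by positivity
  have hx : |x| ≤ L ^ p⁻¹ := by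
    rw [Real.le_rpow_inv_iff_of_pos (abs_nonneg x) hL0 hp, hL]
    linarith [Real.rpow_nonneg (abs_nonneg y) q]
  have hy : |y| ≤ L ^ q⁻¹ := by
    rw [Real.le_rpow_inv_iff_of_pos (abs_nonneg y) hL0 hq, hL]
    linarith [Real.rpow_nonneg (abs_nonneg x) p]
  have small : ∀ {r s l : ℝ}, 0 < r → |s| ≤ L ^ r⁻¹ → L < l → |s * l ^ (-r⁻¹)| ≤ 1 := by
    intro r s l hr hs hl
    have hl0 : 0 < l := hL0.trans_lt hl
    rw [abs_mul, Real.rpow_neg hl0.le, abs_inv, abs_of_nonneg (Real.rpow_nonneg hl0.le _),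
      ← div_eq_mul_inv, div_le_one (Real.rpow_pos_of_pos hl0 _)]
    exact hs.trans (Real.rpow_le_rpow hL0 hl.le (inv_nonneg.2 hr.le))
  obtain ⟨ip, vp⟩ := setIntegral_rpow_neg_inv hpq hL0
  obtain ⟨iq, vq⟩ := setIntegral_rpow_neg_inv hpq.symm hL0
  calc bellman p q x y
      ≤ ∫⁻ l in Set.Ioi (0 : ℝ), (Set.Ioc 0 L).indicator
          (fun l => ENNReal.ofReal (|x| * l ^ (-p⁻¹) + |y| * l ^ (-q⁻¹))) l := by
        refine setLIntegral_mono_ae' measurableSet_Ioi (ae_of_all _ fun l (hl : 0 < l) => ?_)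
        by_cases hlL : l ≤ L
        · rw [Set.indicator_of_mem (show l ∈ Set.Ioc 0 L from ⟨hl, hlL⟩)]
          refine ENNReal.ofReal_le_ofReal ((profile_le _ _).trans ?_)
          rw [abs_mul, abs_mul, abs_of_nonneg (Real.rpow_nonneg hl.le (-p⁻¹)),
            abs_of_nonneg (Real.rpow_nonneg hl.le (-q⁻¹))]
        · rw [profile_eq_zero (small hp hx (not_le.1 hlL)) (small hq hy (not_le.1 hlL))]
          simp
    _ = ∫⁻ l in Set.Ioc 0 L, ENNReal.ofReal (|x| * l ^ (-p⁻¹) + |y| * l ^ (-q⁻¹)) := by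
        rw [lintegral_indicator measurableSet_Ioc, Measure.restrict_restrict measurableSet_Ioc,
          Set.inter_eq_left.2 Set.Ioc_subset_Ioi_self]
    _ = ENNReal.ofReal (|x| * (q * L ^ q⁻¹) + |y| * (p * L ^ p⁻¹)) := by
        rw [← vp, ← vq, ← integral_const_mul, ← integral_const_mul,
          ← integral_add (ip.const_mul _) (iq.const_mul _)]
        refine (ofReal_integral_eq_lintegral_ofReal
          ((ip.const_mul _).add (iq.const_mul _)) ?_).symm
        refine (ae_restrict_iff' measurableSet_Ioc).2 (ae_of_all _ fun l hl => ?_)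
        have := hl.1
        simp only [Pi.zero_apply, Pi.add_apply]
        positivity
    _ ≤ _ := by
        refine ENNReal.ofReal_le_ofReal ?_
        have h : L ^ p⁻¹ * L ^ q⁻¹ = L := by
          rw [← Real.rpow_add_of_nonneg hL0 (inv_nonneg.2 hp.le) (inv_nonneg.2 hq.le),
            hpq.inv_add_inv_eq_one, Real.rpow_one]
        calc |x| * (q * L ^ q⁻¹) + |y| * (p * L ^ p⁻¹)
            ≤ L ^ p⁻¹ * (q * L ^ q⁻¹) + L ^ q⁻¹ * (p * L ^ p⁻¹) := by gcongr
          _ = (p + q) * (L ^ p⁻¹ * L ^ q⁻¹) := by ring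
          _ = _ := by rw [h]

lemma card_mul_bellman_average_le {ι : Type*} [Fintype ι] [Nonempty ι] (p q : ℝ)
    (x y : ι → ℝ) :
    (Fintype.card ι : ENNReal) *
        bellman p q ((∑ k, x k) / Fintype.card ι) ((∑ k, y k) / Fintype.card ι) ≤
      ∑ k, bellman p q (x k) (y k) := by
  unfold bellman
  rw [← lintegral_finsetSum _ fun k _ => measurable_scaled_profile_right p q (x k) (y k),
    ← lintegral_const_mul _ (measurable_scaled_profile_right p q _ _)]
  refine lintegral_mono fun l => ?_
  rw [← ENNReal.ofReal_sum_of_nonneg fun k _ => profile_nonneg _ _, ← ENNReal.ofReal_natCast,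
    ← ENNReal.ofReal_mul (Nat.cast_nonneg _)]
  refine ENNReal.ofReal_le_ofReal ?_
  have h := card_mul_profile_average_le (fun k => x k * l ^ (-p⁻¹)) (fun k => y k * l ^ (-q⁻¹))
  simp only [← Finset.sum_mul] at h
  rwa [div_mul_eq_mul_div, div_mul_eq_mul_div]

/-- The constant in the strong midpoint convexity of `bellman`. -/
def bellmanGain (p q : ℝ) : ℝ := 1 / (4 * (1 + 4 * 8 ^ (p + q)) ^ 3)

lemma bellmanGain_pos (p q : ℝ) : 0 < bellmanGain p q := by
  unfold bellmanGain; positivity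

lemma two_mul_bellman_midpoint_add_le_of_max {p q : ℝ} (hpq : p.HolderConjugate q)
    {M x y x' y' : ℝ} (hM : 0 < M) (hx : |x| ≤ M ^ p⁻¹) (hy : |y| ≤ M ^ q⁻¹)
    (hx' : |x'| ≤ M ^ p⁻¹) (hy' : |y'| ≤ M ^ q⁻¹)
    (h : (|x| = M ^ p⁻¹ ∨ |y| = M ^ q⁻¹) ∨ (|x'| = M ^ p⁻¹ ∨ |y'| = M ^ q⁻¹)) :
    2 * bellman p q ((x + x') / 2) ((y + y') / 2) +
        ENNReal.ofReal (bellmanGain p q * (|x - x'| * |y - y'|)) ≤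
      bellman p q x y + bellman p q x' y' := by
  have hp := hpq.pos
  have hq := hpq.symm.pos
  set T : ℝ := 8 ^ (p + q) with hT
  have hT1 : 1 ≤ T := Real.one_le_rpow (by norm_num) (by positivity)
  have hT0 : 0 < T := by linarith
  set G : ℝ := |x - x'| * |y - y'| with hG
  have hG0 : 0 ≤ G := by positivity
  set I := Set.Icc (M / (2 * T)) (M / T)
  have hIpos : I ⊆ Set.Ioi 0 := fun l hl => lt_of_lt_of_le (by positivity) hl.1
  have upper : ∀ {r s l : ℝ}, 1 < r → |s| ≤ M ^ r⁻¹ → l ∈ I → |s * l ^ (-r⁻¹)| ≤ 2 * T := by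
    intro r s l hr hs hl
    have hl0 : 0 < l := hIpos hl
    rw [abs_mul, abs_of_nonneg (Real.rpow_nonneg hl0.le _), Real.rpow_neg hl0.le]
    calc |s| * (l ^ r⁻¹)⁻¹ ≤ M ^ r⁻¹ * (l ^ r⁻¹)⁻¹ := by gcongr
      _ = (M / l) ^ r⁻¹ := by rw [Real.div_rpow hM.le hl0.le, div_eq_mul_inv]
      _ ≤ (2 * T) ^ r⁻¹ := by
          gcongr
          rw [div_le_iff₀ hl0]
          have := (div_le_iff₀ (by positivity)).1 hl.1
          linarith
      _ ≤ (2 * T) ^ (1 : ℝ) :=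
          Real.rpow_le_rpow_of_exponent_le (by linarith) (inv_le_one_of_one_le₀ hr.le)
      _ = 2 * T := Real.rpow_one _
  have lower : ∀ {r s l : ℝ}, 0 < r → r ≤ p + q → |s| = M ^ r⁻¹ → l ∈ I →
      9 ≤ (s * l ^ (-r⁻¹)) ^ 2 := by
    intro r s l hr hrpq hs hl
    have hl0 : 0 < l := hIpos hl
    have : 8 ≤ |s * l ^ (-r⁻¹)| := by
      rw [abs_mul, abs_of_nonneg (Real.rpow_nonneg hl0.le _), Real.rpow_neg hl0.le, hs,
        ← div_eq_mul_inv, ← Real.div_rpow hM.le hl0.le,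
        Real.le_rpow_inv_iff_of_pos (by norm_num) (by positivity) hr]
      calc (8 : ℝ) ^ r ≤ T := Real.rpow_le_rpow_of_exponent_le (by norm_num) hrpq
        _ ≤ M / l := by
          rw [le_div_iff₀ hl0]
          have := (le_div_iff₀ hT0).1 hl.2
          linarith
    rw [← sq_abs]
    nlinarith
  set c : ℝ := 1 / (2 * (1 + 4 * T) ^ 3) with hc
  have pointwise : ∀ l ∈ Set.Ioi (0 : ℝ),
      2 * ENNReal.ofReal
          (profile ((x + x') / 2 * l ^ (-p⁻¹)) ((y + y') / 2 * l ^ (-q⁻¹))) +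
        I.indicator (fun _ => ENNReal.ofReal (c * G * (T / M))) l ≤
      ENNReal.ofReal (profile (x * l ^ (-p⁻¹)) (y * l ^ (-q⁻¹))) +
        ENNReal.ofReal (profile (x' * l ^ (-p⁻¹)) (y' * l ^ (-q⁻¹))) := by
    intro l hl
    have hl0 : 0 < l := hl
    have ex : (x + x') / 2 * l ^ (-p⁻¹) = (x * l ^ (-p⁻¹) + x' * l ^ (-p⁻¹)) / 2 := by ring
    have ey : (y + y') / 2 * l ^ (-q⁻¹) = (y * l ^ (-q⁻¹) + y' * l ^ (-q⁻¹)) / 2 := by ring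
    rw [ex, ey, ← ENNReal.ofReal_add (profile_nonneg _ _) (profile_nonneg _ _),
      ← ENNReal.ofReal_ofNat 2, ← ENNReal.ofReal_mul (by norm_num)]
    by_cases hlI : l ∈ I
    · rw [Set.indicator_of_mem hlI, ← ENNReal.ofReal_add
        (mul_nonneg (by norm_num) (profile_nonneg _ _)) (by positivity)]
      refine ENNReal.ofReal_le_ofReal (le_trans (add_le_add le_rfl ?_)
        (two_mul_profile_midpoint_add_le (upper hpq.lt hx hlI) (upper hpq.symm.lt hy hlI)
          (upper hpq.lt hx' hlI) (upper hpq.symm.lt hy' hlI) ?_))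
      · have hll : l ^ (-p⁻¹) * l ^ (-q⁻¹) = l⁻¹ := by
          rw [← Real.rpow_add hl0, ← neg_add, hpq.inv_add_inv_eq_one, Real.rpow_neg_one]
        have e : |x * l ^ (-p⁻¹) - x' * l ^ (-p⁻¹)| * |y * l ^ (-q⁻¹) - y' * l ^ (-q⁻¹)| =
            G * l⁻¹ := by
          rw [← sub_mul, ← sub_mul, abs_mul, abs_mul,
            abs_of_nonneg (Real.rpow_nonneg hl0.le (-p⁻¹)),
            abs_of_nonneg (Real.rpow_nonneg hl0.le (-q⁻¹)), ← hll, hG]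
          ring
        have e2 : 1 + 2 * (2 * T) = 1 + 4 * T := by ring
        rw [e, e2, div_eq_mul_one_div (G * l⁻¹), ← hc]
        have : T / M ≤ l⁻¹ := by
          rw [div_le_iff₀ hM, inv_mul_eq_div, le_div_iff₀ hl0]
          have := (le_div_iff₀ hT0).1 hlI.2
          linarith
        calc c * G * (T / M) ≤ c * G * l⁻¹ := by gcongr
          _ = _ := by ring
      · rcases h with (h | h) | (h | h)
        · exact Or.inl (by nlinarith [lower hp (by linarith) h hlI])
        · exact Or.inl (by nlinarith [lower hq (by linarith) h hlI])
        · exact Or.inr (by nlinarith [lower hp (by linarith) h hlI])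
        · exact Or.inr (by nlinarith [lower hq (by linarith) h hlI])
    · rw [Set.indicator_of_notMem hlI, add_zero]
      exact ENNReal.ofReal_le_ofReal (two_mul_profile_midpoint_le _ _ _ _)
  have hI : MeasurableSet I := measurableSet_Icc
  have e : ENNReal.ofReal (bellmanGain p q * G) =
      ∫⁻ l in Set.Ioi (0 : ℝ), I.indicator (fun _ => ENNReal.ofReal (c * G * (T / M))) l := by
    rw [lintegral_indicator hI, Measure.restrict_restrict hI, Set.inter_eq_left.2 hIpos,
      setLIntegral_const, Real.volume_Icc, ← ENNReal.ofReal_mul (by positivity)]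
    congr 1
    rw [bellmanGain, ← hT, hc]
    field_simp
    ring
  rw [e]
  unfold bellman
  rw [← lintegral_const_mul _ (measurable_scaled_profile_right p q _ _),
    ← lintegral_add_left ((measurable_scaled_profile_right p q _ _).const_mul _),
    ← lintegral_add_left (measurable_scaled_profile_right p q _ _)]
  exact setLIntegral_mono_ae' measurableSet_Ioi (ae_of_all _ pointwise)

lemma two_mul_bellman_midpoint_add_le {p q : ℝ} (hpq : p.HolderConjugate q)
    (x y x' y' : ℝ) :
    2 * bellman p q ((x + x') / 2) ((y + y') / 2) +
        ENNReal.ofReal (bellmanGain p q * (|x - x'| * |y - y'|)) ≤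
      bellman p q x y + bellman p q x' y' := by
  have hp := hpq.pos
  have hq := hpq.symm.pos
  set M := max (max (|x| ^ p) (|y| ^ q)) (max (|x'| ^ p) (|y'| ^ q)) with hM
  have h1 : |x| ^ p ≤ M := by simp [hM]
  have h2 : |y| ^ q ≤ M := by simp [hM]
  have h3 : |x'| ^ p ≤ M := by simp [hM]
  have h4 : |y'| ^ q ≤ M := by simp [hM]
  have hM0 : 0 ≤ M := (Real.rpow_nonneg (abs_nonneg x) p).trans h1
  have le_of : ∀ {s r : ℝ}, 0 < r → |s| ^ r ≤ M → |s| ≤ M ^ r⁻¹ := fun hr h =>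
    (Real.le_rpow_inv_iff_of_pos (abs_nonneg _) hM0 hr).2 h
  have eq_of : ∀ {s r : ℝ}, 0 < r → M = |s| ^ r → |s| = M ^ r⁻¹ := fun hr h =>
    (Real.eq_rpow_inv (abs_nonneg _) hM0 hr.ne').2 h.symm
  rcases hM0.eq_or_lt with h0 | hpos
  · have hx : x = 0 := by
      have := le_of hp h1
      rwa [← h0, Real.zero_rpow (inv_ne_zero hp.ne'), abs_nonpos_iff] at this
    have hx' : x' = 0 := by
      have := le_of hp h3
      rwa [← h0, Real.zero_rpow (inv_ne_zero hp.ne'), abs_nonpos_iff] at this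
    have h := card_mul_bellman_average_le p q ![x, x'] ![y, y']
    simp only [Fin.sum_univ_two, Fintype.card_fin] at h
    simpa [hx, hx'] using h
  · refine two_mul_bellman_midpoint_add_le_of_max hpq hpos (le_of hp h1) (le_of hq h2)
      (le_of hp h3) (le_of hq h4) ?_
    rcases max_choice (max (|x| ^ p) (|y| ^ q)) (max (|x'| ^ p) (|y'| ^ q)) with h | h
    · rcases max_choice (|x| ^ p) (|y| ^ q) with h' | h'
      · exact Or.inl (Or.inl (eq_of hp (hM.trans (h.trans h'))))
      · exact Or.inl (Or.inr (eq_of hq (hM.trans (h.trans h'))))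
    · rcases max_choice (|x'| ^ p) (|y'| ^ q) with h' | h'
      · exact Or.inr (Or.inl (eq_of hp (hM.trans (h.trans h'))))
      · exact Or.inr (Or.inr (eq_of hq (hM.trans (h.trans h'))))

lemma two_card_mul_bellman_average_add_le {p q : ℝ} (hpq : p.HolderConjugate q)
    {ι : Type*} [Fintype ι] [DecidableEq ι] (x y : ι → ℝ) (i j : ι) :
    2 * (Fintype.card ι * bellman p q ((∑ k, x k) / Fintype.card ι)
          ((∑ k, y k) / Fintype.card ι)) +
        ENNReal.ofReal (bellmanGain p q * (|x i - x j| * |y i - y j|)) ≤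
      2 * ∑ k, bellman p q (x k) (y k) := by
  have : Nonempty ι := ⟨i⟩
  set σ := Equiv.swap i j with hσ
  have half : ∀ z : ι → ℝ, ∑ k, (z k + z (σ k)) / 2 = ∑ k, z k := fun z => by
    rw [← Finset.sum_div, Finset.sum_add_distrib, Equiv.sum_comp σ z]; ring
  have h := card_mul_bellman_average_le p q (fun k => (x k + x (σ k)) / 2)
    (fun k => (y k + y (σ k)) / 2)
  rw [half x, half y] at h
  calc _ ≤ 2 * (∑ k, bellman p q ((x k + x (σ k)) / 2) ((y k + y (σ k)) / 2)) +
        ∑ k, ENNReal.ofReal (bellmanGain p q * (|x k - x (σ k)| * |y k - y (σ k)|)) := by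
        refine add_le_add (by gcongr) ?_
        have := Finset.single_le_sum (f := fun k => ENNReal.ofReal
          (bellmanGain p q * (|x k - x (σ k)| * |y k - y (σ k)|)))
          (fun _ _ => zero_le) (Finset.mem_univ i)
        simpa [hσ] using this
    _ ≤ ∑ k, (bellman p q (x k) (y k) + bellman p q (x (σ k)) (y (σ k))) := by
        rw [Finset.mul_sum, ← Finset.sum_add_distrib]
        exact Finset.sum_le_sum fun k _ => two_mul_bellman_midpoint_add_le hpq _ _ _ _
    _ = _ := by
        rw [Finset.sum_add_distrib, Equiv.sum_comp σ fun k => bellman p q (x k) (y k), two_mul]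

lemma two_card_mul_bellman_average_add_le_cross {p q : ℝ} (hpq : p.HolderConjugate q)
    {ι : Type*} [Fintype ι] [DecidableEq ι] (x y : ι → ℝ) (i j k : ι) :
    2 * (Fintype.card ι * bellman p q ((∑ k, x k) / Fintype.card ι)
          ((∑ k, y k) / Fintype.card ι)) +
        ENNReal.ofReal (bellmanGain p q / 4 * (|x i - x k| * |y j - y k|)) ≤
      2 * ∑ k, bellman p q (x k) (y k) := by
  have hc := bellmanGain_pos p q
  have reduce : ∀ i' j', |x i - x k| * |y j - y k| ≤ 4 * (|x i' - x j'| * |y i' - y j'|) →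
      2 * (Fintype.card ι * bellman p q ((∑ k, x k) / Fintype.card ι)
          ((∑ k, y k) / Fintype.card ι)) +
        ENNReal.ofReal (bellmanGain p q / 4 * (|x i - x k| * |y j - y k|)) ≤
      2 * ∑ k, bellman p q (x k) (y k) := fun i' j' h => by
    refine le_trans (add_le_add le_rfl (ENNReal.ofReal_le_ofReal ?_))
      (two_card_mul_bellman_average_add_le hpq x y i' j')
    nlinarith
  by_cases h1 : |y j - y k| ≤ 4 * |y i - y k|
  · refine reduce i k ?_
    nlinarith [abs_nonneg (x i - x k)]
  by_cases h2 : |x i - x k| ≤ 4 * |x j - x k|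
  · refine reduce j k ?_
    nlinarith [abs_nonneg (y j - y k)]
  refine reduce i j ?_
  push Not at h1 h2
  have hx : |x i - x k| ≤ 2 * |x i - x j| := by
    have := abs_sub_le (x i) (x j) (x k)
    linarith [abs_nonneg (x i - x k)]
  have hy : |y j - y k| ≤ 2 * |y i - y j| := by
    have := abs_sub_le (y j) (y i) (y k)
    rw [abs_sub_comm (y j) (y i)] at this
    linarith [abs_nonneg (y j - y k)]
  calc _ ≤ (2 * |x i - x j|) * (2 * |y i - y j|) := by gcongr
    _ = _ := by ring

end Bellman

section Walk

variable {E : Type*} [NormedAddCommGroup E]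

/-- Continuous functions with compact support. -/
def IsTest (f : E → ℝ) : Prop := Continuous f ∧ HasCompactSupport f

namespace IsTest

variable {f g : E → ℝ}

lemma translate (hf : IsTest f) (a : E) : IsTest fun x => f (x + a) :=
  ⟨hf.1.comp (continuous_add_const a), hf.2.comp_homeomorph (Homeomorph.addRight a)⟩

lemma comp (hf : IsTest f) {G : ℝ → ℝ} (hG : Continuous G) (h0 : G 0 = 0) :
    IsTest fun x => G (f x) :=
  ⟨hG.comp hf.1, hf.2.comp_left h0⟩

lemma add (hf : IsTest f) (hg : IsTest g) : IsTest fun x => f x + g x :=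
  ⟨hf.1.add hg.1, hf.2.add hg.2⟩

lemma mul (hf : IsTest f) (hg : IsTest g) : IsTest fun x => f x * g x :=
  ⟨hf.1.mul hg.1, hf.2.mul_right⟩

lemma abs (hf : IsTest f) : IsTest fun x => |f x| := hf.comp continuous_abs abs_zero

lemma const_mul (hf : IsTest f) (c : ℝ) : IsTest fun x => c * f x :=
  hf.comp (continuous_const_mul c) (mul_zero c)

lemma div_const (hf : IsTest f) (c : ℝ) : IsTest fun x => f x / c :=
  hf.comp (continuous_id.div_const c) (zero_div c)

lemma sub (hf : IsTest f) (hg : IsTest g) : IsTest fun x => f x - g x := by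
  simpa [sub_eq_add_neg] using hf.add (hg.const_mul (-1))

lemma sum {ι : Type*} (s : Finset ι) {F : ι → E → ℝ} (hF : ∀ k, IsTest (F k)) :
    IsTest fun x => ∑ k ∈ s, F k x := by
  classical
  induction s using Finset.induction_on with
  | empty => simpa using ⟨continuous_const, HasCompactSupport.zero⟩
  | insert k s hk ih => simpa [Finset.sum_insert hk] using (hF k).add ih

lemma abs_rpow (hf : IsTest f) {p : ℝ} (hp : 0 < p) : IsTest fun x => |f x| ^ p :=
  hf.comp (G := fun t => |t| ^ p) (continuous_abs.rpow_const fun _ => Or.inr hp.le)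
    (by simp [hp.ne'])

lemma integrable [MeasurableSpace E] [BorelSpace E] {μ : Measure E}
    [IsFiniteMeasureOnCompacts μ] (hf : IsTest f) : Integrable f μ :=
  hf.1.integrable_of_hasCompactSupport hf.2

end IsTest

variable {ι : Type*} [Fintype ι]

/-- One step of the random walk with uniformly distributed increments `e k`. -/
def stepAverage (e : ι → E) (f : E → ℝ) (x : E) : ℝ := (∑ k, f (x + e k)) / Fintype.card ι

lemma IsTest.stepAverage {f : E → ℝ} (hf : IsTest f) (e : ι → E) :
    IsTest (stepAverage e f) :=
  (IsTest.sum _ fun k => hf.translate (e k)).div_const _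

lemma IsTest.iterate_stepAverage {f : E → ℝ} (hf : IsTest f) (e : ι → E) (n : ℕ) :
    IsTest ((_root_.stepAverage e)^[n] f) := by
  induction n with
  | zero => exact hf
  | succ n ih => rw [Function.iterate_succ_apply']; exact ih.stepAverage e

variable [MeasurableSpace E] [BorelSpace E] (μ : Measure E) [μ.IsAddRightInvariant]

lemma lintegral_bellman_stepAverage_add_le [DecidableEq ι] {p q : ℝ}
    (hpq : p.HolderConjugate q) (e : ι → E) {f φ : E → ℝ} (hf : Continuous f)
    (hφ : Continuous φ) (i j k : ι) :
    2 * Fintype.card ι * ∫⁻ x, bellman p q (stepAverage e f x) (stepAverage e φ x) ∂μ +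
        ∫⁻ x, ENNReal.ofReal (bellmanGain p q / 4 *
          (|f (x + e i) - f (x + e k)| * |φ (x + e j) - φ (x + e k)|)) ∂μ ≤
      2 * Fintype.card ι * ∫⁻ x, bellman p q (f x) (φ x) ∂μ := by
  have hm : Measurable fun x => bellman p q (f x) (φ x) :=
    Measurable.bellman p q hf.measurable hφ.measurable
  have hm' : ∀ l, Measurable fun x => bellman p q (f (x + e l)) (φ (x + e l)) := fun l =>
    hm.comp (measurable_add_const (e l))
  have hgain : Measurable fun x => ENNReal.ofReal (bellmanGain p q / 4 *
      (|f (x + e i) - f (x + e k)| * |φ (x + e j) - φ (x + e k)|)) := by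
    refine (Continuous.measurable ?_).ennreal_ofReal
    fun_prop
  have hsum : ∫⁻ x, 2 * ∑ l, bellman p q (f (x + e l)) (φ (x + e l)) ∂μ =
      2 * Fintype.card ι * ∫⁻ x, bellman p q (f x) (φ x) ∂μ := by
    rw [lintegral_const_mul' _ _ (by simp), lintegral_finsetSum _ fun l _ => hm' l]
    simp_rw [lintegral_add_right_eq_self (fun x => bellman p q (f x) (φ x))]
    simp [mul_assoc]
  rw [← hsum, ← lintegral_const_mul' _ _ (ENNReal.mul_ne_top (by simp) (by simp)),
    ← lintegral_add_right _ hgain]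
  refine lintegral_mono fun x => ?_
  rw [mul_assoc]
  exact two_card_mul_bellman_average_add_le_cross hpq (fun l => f (x + e l))
    (fun l => φ (x + e l)) i j k

variable [IsFiniteMeasureOnCompacts μ]

lemma exists_sum_integral_increments_le [DecidableEq ι] {p q : ℝ}
    (hpq : p.HolderConjugate q) :
    ∃ C : ℝ, 0 ≤ C ∧ ∀ (e : ι → E) (f φ : E → ℝ), IsTest f → IsTest φ →
      ∀ (i j k : ι) (N : ℕ),
        ∑ n ∈ Finset.range N,
          ∫ x, |(stepAverage e)^[n] f (x + e i) - (stepAverage e)^[n] f (x + e k)| *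
            |(stepAverage e)^[n] φ (x + e j) - (stepAverage e)^[n] φ (x + e k)| ∂μ ≤
        C * (∫ x, |f x| ^ p ∂μ + ∫ x, |φ x| ^ q ∂μ) := by
  have hp := hpq.pos
  have hq := hpq.symm.pos
  have hc := bellmanGain_pos p q
  refine ⟨2 * Fintype.card ι * (p + q) * (4 / bellmanGain p q), by positivity,
    fun e f φ hf hφ i j k N => ?_⟩
  set F := fun n => (stepAverage e)^[n] f with hF
  set G := fun n => (stepAverage e)^[n] φ with hG
  have hFt : ∀ n, IsTest (F n) := hf.iterate_stepAverage e
  have hGt : ∀ n, IsTest (G n) := hφ.iterate_stepAverage e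
  set J := fun n x => |F n (x + e i) - F n (x + e k)| * |G n (x + e j) - G n (x + e k)| with hJ
  have hJt : ∀ n, IsTest (J n) := fun n =>
    (((hFt n).translate _).sub ((hFt n).translate _)).abs.mul
      (((hGt n).translate _).sub ((hGt n).translate _)).abs
  have hJ0 : ∀ n x, 0 ≤ J n x := fun n x => by positivity
  have iter : 2 * Fintype.card ι * ∫⁻ x, bellman p q (F N x) (G N x) ∂μ +
      ∑ n ∈ Finset.range N, ∫⁻ x, ENNReal.ofReal (bellmanGain p q / 4 * J n x) ∂μ ≤
      2 * Fintype.card ι * ∫⁻ x, bellman p q (f x) (φ x) ∂μ := by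
    induction N with
    | zero => simp [hF, hG]
    | succ N ih =>
      refine le_trans ?_ ih
      rw [Finset.sum_range_succ, add_comm (∑ n ∈ Finset.range N, _), ← add_assoc]
      refine add_le_add ?_ le_rfl
      have h := lintegral_bellman_stepAverage_add_le μ hpq e (hFt N).1 (hGt N).1 i j k
      simpa only [hF, hG, hJ, Function.iterate_succ_apply'] using h
  have conv : ∀ {H : E → ℝ}, IsTest H → (∀ x, 0 ≤ H x) →
      ∫⁻ x, ENNReal.ofReal (H x) ∂μ = ENNReal.ofReal (∫ x, H x ∂μ) := fun hH h0 =>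
    (ofReal_integral_eq_lintegral_ofReal hH.integrable (ae_of_all _ h0)).symm
  have hup : ∫⁻ x, bellman p q (f x) (φ x) ∂μ ≤
      ENNReal.ofReal ((p + q) * (∫ x, |f x| ^ p ∂μ + ∫ x, |φ x| ^ q ∂μ)) := by
    rw [← integral_add (hf.abs_rpow hp).integrable (hφ.abs_rpow hq).integrable,
      ← integral_const_mul, ← conv (((hf.abs_rpow hp).add (hφ.abs_rpow hq)).const_mul _)
        (fun x => by positivity)]
    exact lintegral_mono fun x => bellman_le hpq _ _
  have hI : 0 ≤ ∫ x, |f x| ^ p ∂μ + ∫ x, |φ x| ^ q ∂μ :=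
    add_nonneg (integral_nonneg fun x => by positivity) (integral_nonneg fun x => by positivity)
  have main : ENNReal.ofReal (bellmanGain p q / 4 * ∑ n ∈ Finset.range N, ∫ x, J n x ∂μ) ≤
      ENNReal.ofReal (2 * Fintype.card ι *
        ((p + q) * (∫ x, |f x| ^ p ∂μ + ∫ x, |φ x| ^ q ∂μ))) := by
    rw [Finset.mul_sum, ENNReal.ofReal_sum_of_nonneg fun n _ =>
      mul_nonneg (by positivity) (integral_nonneg (hJ0 n)),
      ENNReal.ofReal_mul (by positivity), ENNReal.ofReal_mul (by positivity)]
    simp_rw [← integral_const_mul]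
    calc _ = ∑ n ∈ Finset.range N, ∫⁻ x, ENNReal.ofReal (bellmanGain p q / 4 * J n x) ∂μ :=
          Finset.sum_congr rfl fun n _ => (conv ((hJt n).const_mul _)
            fun x => mul_nonneg (by positivity) (hJ0 n x)).symm
      _ ≤ _ := le_trans le_add_self iter
      _ ≤ _ := by
        rw [ENNReal.ofReal_natCast, ENNReal.ofReal_ofNat]
        gcongr
  have := (ENNReal.ofReal_le_ofReal_iff (by positivity)).1 main
  calc ∑ n ∈ Finset.range N, ∫ x, J n x ∂μ
      = (4 / bellmanGain p q) * (bellmanGain p q / 4 * ∑ n ∈ Finset.range N, ∫ x, J n x ∂μ) := by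
        field_simp
    _ ≤ (4 / bellmanGain p q) * _ := mul_le_mul_of_nonneg_left this (by positivity)
    _ = _ := by ring

lemma integral_abs_stepAverage_rpow_le [Nonempty ι] {p : ℝ} (hp : 1 ≤ p) (e : ι → E)
    {f : E → ℝ} (hf : IsTest f) :
    ∫ x, |stepAverage e f x| ^ p ∂μ ≤ ∫ x, |f x| ^ p ∂μ := by
  have hp0 : 0 < p := by linarith
  have hN : (0 : ℝ) < Fintype.card ι := by exact_mod_cast Fintype.card_pos
  have ht : ∀ k, IsTest fun x => |f (x + e k)| ^ p := fun k => (hf.translate _).abs_rpow hp0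
  calc ∫ x, |stepAverage e f x| ^ p ∂μ
      ≤ ∫ x, (∑ k, |f (x + e k)| ^ p) / Fintype.card ι ∂μ := by
        refine integral_mono ((hf.stepAverage e).abs_rpow hp0).integrable
          ((IsTest.sum _ ht).div_const _).integrable fun x => ?_
        have h := Real.rpow_arith_mean_le_arith_mean_rpow Finset.univ
          (fun _ : ι => (Fintype.card ι : ℝ)⁻¹) (fun k => |f (x + e k)|)
          (fun _ _ => by positivity) (by simp [hN.ne']) (fun _ _ => abs_nonneg _) hp
        rw [← Finset.mul_sum, ← Finset.mul_sum, inv_mul_eq_div, inv_mul_eq_div] at h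
        refine le_trans ?_ h
        refine Real.rpow_le_rpow (abs_nonneg _) ?_ hp0.le
        rw [stepAverage, abs_div, abs_of_pos hN]
        gcongr
        exact Finset.abs_sum_le_sum_abs _ _
    _ = ∫ x, |f x| ^ p ∂μ := by
        rw [integral_div, integral_finsetSum _ fun k _ => (ht k).integrable]
        simp_rw [integral_add_right_eq_self (fun x => |f x| ^ p)]
        simp [hN.ne']

lemma integral_abs_iterate_stepAverage_rpow_le [Nonempty ι] {p : ℝ} (hp : 1 ≤ p) (e : ι → E)
    {f : E → ℝ} (hf : IsTest f) (n : ℕ) :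
    ∫ x, |(stepAverage e)^[n] f x| ^ p ∂μ ≤ ∫ x, |f x| ^ p ∂μ := by
  induction n with
  | zero => exact le_rfl
  | succ n ih =>
    rw [Function.iterate_succ_apply']
    exact (integral_abs_stepAverage_rpow_le μ hp e (hf.iterate_stepAverage e n)).trans ih

end Walk

section Discrete

variable {E : Type*} [NormedAddCommGroup E]

/-- The increment of `f` along the vector `a`. -/
def increment (a : E) (f : E → ℝ) (x : E) : ℝ := f (x + a) - f x

/-- The increments of the nearest neighbour walk spanned by `a` and `b`. -/
def crossSteps (a b : E) : Fin 5 → E := ![0, a, -a, b, -b]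

/-- The discrete divergence, up to sign, of the planar field `(u, v)`. -/
def discreteDiv (a b : E) (u v : E → ℝ) (x : E) : ℝ :=
  increment (-a) u x + increment (-b) v x

/-- The discrete curl of the planar field `(u, v)`. -/
def discreteCurl (a b : E) (u v : E → ℝ) (x : E) : ℝ :=
  increment a v x - increment b u x

section Algebra

variable (a b : E) (u v : E → ℝ)

lemma stepAverage_crossSteps (x : E) :
    stepAverage (crossSteps a b) u x =
      (u x + u (x + a) + u (x + -a) + u (x + b) + u (x + -b)) / 5 := by
  simp [stepAverage, crossSteps, Fin.sum_univ_five]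

lemma stepAverage_increment (c : E) :
    stepAverage (crossSteps a b) (increment c u) =
      increment c (stepAverage (crossSteps a b) u) := by
  ext x
  simp only [stepAverage_crossSteps, increment, add_right_comm x _ c]
  ring

lemma stepAverage_discreteDiv :
    stepAverage (crossSteps a b) (discreteDiv a b u v) =
      discreteDiv a b (stepAverage (crossSteps a b) u) (stepAverage (crossSteps a b) v) := by
  ext x
  unfold discreteDiv
  rw [← stepAverage_increment, ← stepAverage_increment]
  simp only [stepAverage_crossSteps]
  ring

lemma stepAverage_discreteCurl :
    stepAverage (crossSteps a b) (discreteCurl a b u v) =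
      discreteCurl a b (stepAverage (crossSteps a b) u) (stepAverage (crossSteps a b) v) := by
  ext x
  unfold discreteCurl
  rw [← stepAverage_increment, ← stepAverage_increment]
  simp only [stepAverage_crossSteps]
  ring

lemma iterate_stepAverage_discreteDiv (n : ℕ) :
    (stepAverage (crossSteps a b))^[n] (discreteDiv a b u v) =
      discreteDiv a b ((stepAverage (crossSteps a b))^[n] u) ((stepAverage (crossSteps a b))^[n] v) := by
  induction n with
  | zero => rfl
  | succ n ih => simp only [Function.iterate_succ_apply', ih, stepAverage_discreteDiv]

lemma iterate_stepAverage_discreteCurl (n : ℕ) :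
    (stepAverage (crossSteps a b))^[n] (discreteCurl a b u v) =
      discreteCurl a b ((stepAverage (crossSteps a b))^[n] u) ((stepAverage (crossSteps a b))^[n] v) := by
  induction n with
  | zero => rfl
  | succ n ih => simp only [Function.iterate_succ_apply', ih, stepAverage_discreteCurl]

lemma sub_stepAverage_crossSteps (x : E) :
    u x - stepAverage (crossSteps a b) u x =
      (increment a (discreteDiv a b u v) x - increment (-b) (discreteCurl a b u v) x) / 5 := by
  simp only [stepAverage_crossSteps, discreteDiv, discreteCurl, increment,
    add_neg_cancel_right, neg_add_cancel_right, add_right_comm x (-b) a]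
  ring

end Algebra

lemma IsTest.increment {f : E → ℝ} (hf : IsTest f) (a : E) : IsTest (increment a f) :=
  (hf.translate a).sub hf

lemma IsTest.discreteDiv {u v : E → ℝ} (hu : IsTest u) (hv : IsTest v) (a b : E) :
    IsTest (discreteDiv a b u v) :=
  (hu.increment _).add (hv.increment _)

lemma IsTest.discreteCurl {u v : E → ℝ} (hu : IsTest u) (hv : IsTest v) (a b : E) :
    IsTest (discreteCurl a b u v) :=
  (hv.increment _).sub (hu.increment _)

variable [MeasurableSpace E] [BorelSpace E] (μ : Measure E) [μ.IsAddRightInvariant]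
  [IsFiniteMeasureOnCompacts μ]

lemma integral_increment_mul {f g : E → ℝ} (hf : IsTest f) (hg : IsTest g) (c : E) :
    ∫ x, increment c f x * g x ∂μ = ∫ x, f x * increment (-c) g x ∂μ := by
  have h := integral_add_right_eq_self (μ := μ) (fun x => f x * g (x + -c)) c
  simp only [add_neg_cancel_right] at h
  simp only [increment, sub_mul, mul_sub]
  rw [integral_sub ((hf.translate c).mul hg).integrable (hf.mul hg).integrable,
    integral_sub (hf.mul (hg.translate (-c))).integrable (hf.mul hg).integrable, h]

lemma integral_stepAverage_mul {f g : E → ℝ} (hf : IsTest f) (hg : IsTest g) (a b : E) :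
    ∫ x, stepAverage (crossSteps a b) f x * g x ∂μ = ∫ x, f x * stepAverage (crossSteps a b) g x ∂μ := by
  have shift : ∀ c : E, ∫ x, f (x + c) * g x ∂μ = ∫ x, f x * g (x + -c) ∂μ := fun c => by
    simpa only [add_neg_cancel_right] using
      integral_add_right_eq_self (μ := μ) (fun x => f x * g (x + -c)) c
  have left : ∀ k ∈ Finset.univ, Integrable (fun x => f (x + crossSteps a b k) * g x) μ :=
    fun k _ => ((hf.translate _).mul hg).integrable
  have right : ∀ k ∈ Finset.univ, Integrable (fun x => f x * g (x + crossSteps a b k)) μ :=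
    fun k _ => (hf.mul (hg.translate _)).integrable
  simp only [stepAverage, div_mul_eq_mul_div, mul_div_assoc', Finset.sum_mul, Finset.mul_sum]
  rw [integral_div, integral_div, integral_finsetSum _ left, integral_finsetSum _ right]
  simp only [Fin.sum_univ_five, crossSteps, Matrix.cons_val, shift, neg_neg, neg_zero]
  ring

lemma abs_integral_increment_mul_sub_le {u v φ : E → ℝ} (hu : IsTest u) (hv : IsTest v)
    (hφ : IsTest φ) (a b c : E) :
    |∫ x, increment c u x * φ x ∂μ -
        ∫ x, increment c (stepAverage (crossSteps a b) u) x * φ x ∂μ| ≤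
      (∫ x, |increment a (discreteDiv a b u v) x| * |increment (-c) φ x| ∂μ +
        ∫ x, |increment (-b) (discreteCurl a b u v) x| * |increment (-c) φ x| ∂μ) / 5 := by
  have hd := (hu.discreteDiv hv a b).increment a
  have hw := (hu.discreteCurl hv a b).increment (-b)
  have hAu := hu.stepAverage (crossSteps a b)
  have hφ' := hφ.increment (-c)
  rw [integral_increment_mul μ hu hφ, integral_increment_mul μ hAu hφ,
    ← integral_sub (hu.mul hφ').integrable (hAu.mul hφ').integrable,
    ← integral_add (hd.abs.mul hφ'.abs).integrable (hw.abs.mul hφ'.abs).integrable,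
    ← integral_div]
  refine abs_integral_le_integral_abs.trans (integral_mono
    ((hu.mul hφ').sub (hAu.mul hφ')).abs.integrable
    (((hd.abs.mul hφ'.abs).add (hw.abs.mul hφ'.abs)).div_const 5).integrable fun x => ?_)
  simp only
  rw [← sub_mul, sub_stepAverage_crossSteps a b u v, abs_mul, abs_div, abs_of_pos (show (0 : ℝ) < 5 by
    norm_num), ← add_mul, div_mul_eq_mul_div]
  gcongr
  exact abs_sub _ _

lemma exists_sum_integral_crossSteps_le {p q : ℝ} (hpq : p.HolderConjugate q) :
    ∃ C : ℝ, 0 ≤ C ∧ ∀ (a b : E) (f φ : E → ℝ), IsTest f → IsTest φ →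
      ∀ s ∈ Set.range (crossSteps a b), ∀ t ∈ Set.range (crossSteps a b), ∀ N : ℕ,
        ∑ n ∈ Finset.range N, ∫ x, |increment s ((stepAverage (crossSteps a b))^[n] f) x| *
            |increment t ((stepAverage (crossSteps a b))^[n] φ) x| ∂μ ≤
        C * (∫ x, |f x| ^ p ∂μ + ∫ x, |φ x| ^ q ∂μ) := by
  obtain ⟨C, hC, h⟩ := exists_sum_integral_increments_le (ι := Fin 5) μ hpq
  refine ⟨C, hC, ?_⟩
  rintro a b f φ hf hφ _ ⟨i, rfl⟩ _ ⟨j, rfl⟩ N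
  have h0 : crossSteps a b 0 = 0 := rfl
  simpa [h0, increment] using h (crossSteps a b) f φ hf hφ i j 0 N

/-- The increments of `u` dissipate along the walk. -/
lemma tendsto_integral_increment_sq (a b : E) {u : E → ℝ} (hu : IsTest u) {c : E}
    (hc : c ∈ Set.range (crossSteps a b)) :
    Filter.Tendsto
      (fun n => ∫ x, increment c ((stepAverage (crossSteps a b))^[n] u) x ^ 2 ∂μ)
      Filter.atTop (nhds 0) := by
  obtain ⟨C, -, h⟩ := exists_sum_integral_crossSteps_le μ Real.HolderConjugate.two_two
  refine (summable_of_sum_range_le (c := C * (∫ x, |u x| ^ (2 : ℝ) ∂μ + ∫ x, |u x| ^ (2 : ℝ) ∂μ))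
    (fun n => integral_nonneg fun x => sq_nonneg _) fun N => ?_).tendsto_atTop_zero
  simpa only [← sq, sq_abs] using h a b u u hu hu c hc c hc N

lemma tendsto_integral_increment_mul (a b : E) {u φ : E → ℝ} (hu : IsTest u)
    (hφ : IsTest φ) {c : E} (hc : c ∈ Set.range (crossSteps a b)) :
    Filter.Tendsto
      (fun n => ∫ x, increment c ((stepAverage (crossSteps a b))^[n] u) x *
        (stepAverage (crossSteps a b))^[n] φ x ∂μ)
      Filter.atTop (nhds 0) := by
  set A := stepAverage (crossSteps a b)
  set M := ∫ x, |φ x| ^ (2 : ℝ) ∂μ with hM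
  have hM0 : 0 ≤ M := integral_nonneg fun x => by positivity
  have hlim := tendsto_integral_increment_sq μ a b hu hc
  have bound : ∀ t : ℝ, 0 < t → ∀ n, |∫ x, increment c (A^[n] u) x * A^[n] φ x ∂μ| ≤
      t * ∫ x, increment c (A^[n] u) x ^ 2 ∂μ + t⁻¹ * M := by
    intro t ht n
    have hu' := (hu.iterate_stepAverage (crossSteps a b) n).increment c
    have hφ' := hφ.iterate_stepAverage (crossSteps a b) n
    have hu2 : IsTest fun x => increment c (A^[n] u) x ^ 2 := by
      simpa only [sq] using hu'.mul hu'
    have hφ2 : IsTest fun x => |A^[n] φ x| ^ (2 : ℝ) := hφ'.abs_rpow two_pos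
    calc |∫ x, increment c (A^[n] u) x * A^[n] φ x ∂μ|
        ≤ ∫ x, |increment c (A^[n] u) x * A^[n] φ x| ∂μ := abs_integral_le_integral_abs
      _ ≤ ∫ x, (t * increment c (A^[n] u) x ^ 2 + t⁻¹ * |A^[n] φ x| ^ (2 : ℝ)) ∂μ := by
          refine integral_mono (hu'.mul hφ').abs.integrable
            ((hu2.const_mul t).add (hφ2.const_mul t⁻¹)).integrable fun x => ?_
          simp only [Real.rpow_two, abs_mul]
          rw [← sq_abs (increment c (A^[n] u) x)]
          set y := |increment c (A^[n] u) x|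
          set z := |A^[n] φ x|
          have : t * y ^ 2 + t⁻¹ * z ^ 2 - 2 * (y * z) = t⁻¹ * (t * y - z) ^ 2 := by
            field_simp
            ring
          have h2 : 0 ≤ t⁻¹ * (t * y - z) ^ 2 := by positivity
          have h3 : 0 ≤ y * z := by positivity
          linarith
      _ = t * ∫ x, increment c (A^[n] u) x ^ 2 ∂μ + t⁻¹ * ∫ x, |A^[n] φ x| ^ (2 : ℝ) ∂μ := by
          rw [integral_add (hu2.const_mul t).integrable (hφ2.const_mul t⁻¹).integrable,
            integral_const_mul, integral_const_mul]
      _ ≤ _ := by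
          gcongr
          exact integral_abs_iterate_stepAverage_rpow_le μ one_le_two _ hφ n
  rw [Metric.tendsto_atTop]
  intro ε hε
  have ht : 0 < 2 * (M + 1) / ε := by positivity
  obtain ⟨N, hN⟩ := (Metric.tendsto_atTop.1 hlim) (ε / (2 * (2 * (M + 1) / ε))) (by positivity)
  refine ⟨N, fun n hn => ?_⟩
  have h1 := bound _ ht n
  have h2 := hN n hn
  rw [Real.dist_eq, sub_zero] at h2 ⊢
  have h3 := (le_abs_self _).trans_lt h2
  rw [lt_div_iff₀ (by positivity)] at h3
  have h4 : (2 * (M + 1) / ε)⁻¹ * M < ε / 2 := by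
    rw [inv_div, div_mul_eq_mul_div, div_lt_div_iff₀ (by positivity) two_pos]
    nlinarith
  linarith

/-- The bilinear estimate for the discrete analogue of the Beurling transform. -/
theorem exists_integral_increment_mul_le {p q : ℝ} (hpq : p.HolderConjugate q) :
    ∃ C : ℝ, 0 ≤ C ∧ ∀ (a b : E) (u v φ : E → ℝ), IsTest u → IsTest v → IsTest φ →
      ∀ c, c = a ∨ c = b →
        |∫ x, increment c u x * φ x ∂μ| ≤
          C * (∫ x, |discreteDiv a b u v x| ^ p ∂μ + ∫ x, |discreteCurl a b u v x| ^ p ∂μ +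
            ∫ x, |φ x| ^ q ∂μ) := by
  obtain ⟨C, hC, hsum⟩ := exists_sum_integral_crossSteps_le (E := E) μ hpq
  refine ⟨C, hC, fun a b u v φ hu hv hφ c hc => ?_⟩
  set A := stepAverage (crossSteps a b) with hA
  set B := ∫ x, |discreteDiv a b u v x| ^ p ∂μ + ∫ x, |discreteCurl a b u v x| ^ p ∂μ +
    ∫ x, |φ x| ^ q ∂μ with hB
  have mem_a : a ∈ Set.range (crossSteps a b) := ⟨1, rfl⟩
  have mem_b : -b ∈ Set.range (crossSteps a b) := ⟨4, rfl⟩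
  have mem_c : c ∈ Set.range (crossSteps a b) := by
    rcases hc with rfl | rfl
    exacts [⟨1, rfl⟩, ⟨3, rfl⟩]
  have mem_c' : -c ∈ Set.range (crossSteps a b) := by
    rcases hc with rfl | rfl
    exacts [⟨2, rfl⟩, ⟨4, rfl⟩]
  have hI : ∀ f : E → ℝ, ∀ r : ℝ, 0 ≤ ∫ x, |f x| ^ r ∂μ := fun f r =>
    integral_nonneg fun x => Real.rpow_nonneg (abs_nonneg _) _
  set T : (E → ℝ) → (E → ℝ) → ℝ := fun f g => ∫ x, increment c f x * g x ∂μ with hT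
  have sum_le : ∀ U V : E → ℝ, IsTest U → IsTest V →
      ∫ x, |discreteDiv a b U V x| ^ p ∂μ ≤ ∫ x, |discreteDiv a b u v x| ^ p ∂μ →
      ∫ x, |discreteCurl a b U V x| ^ p ∂μ ≤ ∫ x, |discreteCurl a b u v x| ^ p ∂μ →
      ∀ N, ∑ n ∈ Finset.range N,
        |T (A^[n] U) (A^[n] φ) - T (A (A^[n] U)) (A^[n] φ)| ≤ 2 / 5 * (C * B) := by
    intro U V hU hV hd hw N
    have h1 := hsum a b _ φ (hU.discreteDiv hV a b) hφ a mem_a (-c) mem_c' N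
    have h2 := hsum a b _ φ (hU.discreteCurl hV a b) hφ (-b) mem_b (-c) mem_c' N
    have h3 : ∀ n ∈ Finset.range N,
        |T (A^[n] U) (A^[n] φ) - T (A (A^[n] U)) (A^[n] φ)| ≤ _ := fun n _ =>
      abs_integral_increment_mul_sub_le μ (hU.iterate_stepAverage (crossSteps a b) n)
        (hV.iterate_stepAverage (crossSteps a b) n) (hφ.iterate_stepAverage (crossSteps a b) n) a b c
    refine (Finset.sum_le_sum h3).trans ?_
    simp only [iterate_stepAverage_discreteDiv, iterate_stepAverage_discreteCurl] at h1 h2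
    rw [← Finset.sum_div, Finset.sum_add_distrib]
    have h4 : C * (∫ x, |discreteDiv a b U V x| ^ p ∂μ + ∫ x, |φ x| ^ q ∂μ) ≤ C * B := by
      refine mul_le_mul_of_nonneg_left ?_ hC
      linarith [hI (discreteCurl a b u v) p]
    have h5 : C * (∫ x, |discreteCurl a b U V x| ^ p ∂μ + ∫ x, |φ x| ^ q ∂μ) ≤ C * B := by
      refine mul_le_mul_of_nonneg_left ?_ hC
      linarith [hI (discreteDiv a b u v) p]
    linarith
  have move : ∀ n, T (A (A^[n] (A u))) (A^[n] φ) = T (A^[n + 1] u) (A^[n + 1] φ) := by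
    intro n
    have hn : A (A^[n] (A u)) = A (A^[n + 1] u) := by rw [Function.iterate_succ_apply]
    rw [hn, Function.iterate_succ_apply' A n φ]
    simp only [hT]
    rw [← integral_stepAverage_mul μ ((hu.iterate_stepAverage (crossSteps a b) (n + 1)).increment c)
      (hφ.iterate_stepAverage (crossSteps a b) n), stepAverage_increment]
  have tele : ∀ N, |T u φ| ≤ |T (A^[N] u) (A^[N] φ)| + 4 / 5 * (C * B) := by
    intro N
    have h1 := sum_le u v hu hv le_rfl le_rfl N
    have h2 := sum_le (A u) (A v) (hu.stepAverage _) (hv.stepAverage _)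
      (by
        rw [← stepAverage_discreteDiv]
        exact integral_abs_stepAverage_rpow_le μ hpq.lt.le _ (hu.discreteDiv hv a b))
      (by
        rw [← stepAverage_discreteCurl]
        exact integral_abs_stepAverage_rpow_le μ hpq.lt.le _ (hu.discreteCurl hv a b)) N
    have h3 : T u φ - T (A^[N] u) (A^[N] φ) = ∑ n ∈ Finset.range N,
        ((T (A^[n] u) (A^[n] φ) - T (A (A^[n] u)) (A^[n] φ)) +
          (T (A^[n] (A u)) (A^[n] φ) - T (A (A^[n] (A u))) (A^[n] φ))) := by
      have h := Finset.sum_range_sub' (fun n => T (A^[n] u) (A^[n] φ)) N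
      simp only [Function.iterate_zero, id] at h
      rw [← h]
      refine Finset.sum_congr rfl fun n _ => ?_
      rw [move n, ← Function.iterate_succ_apply, ← Function.iterate_succ_apply' A n u]
      ring
    have h4 : |T u φ - T (A^[N] u) (A^[N] φ)| ≤ 4 / 5 * (C * B) := by
      rw [h3, Finset.sum_add_distrib]
      refine (abs_add_le _ _).trans ?_
      have := Finset.abs_sum_le_sum_abs
        (fun n => T (A^[n] u) (A^[n] φ) - T (A (A^[n] u)) (A^[n] φ)) (Finset.range N)
      have := Finset.abs_sum_le_sum_abs
        (fun n => T (A^[n] (A u)) (A^[n] φ) - T (A (A^[n] (A u))) (A^[n] φ)) (Finset.range N)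
      linarith
    have := abs_sub_abs_le_abs_sub (T u φ) (T (A^[N] u) (A^[N] φ))
    linarith
  have hlim := ((tendsto_integral_increment_mul μ a b hu hφ mem_c).abs).add_const
    (4 / 5 * (C * B))
  have h := ge_of_tendsto' hlim tele
  have hCB : 0 ≤ C * B := mul_nonneg hC (add_nonneg (add_nonneg (hI _ _) (hI _ _)) (hI _ _))
  rw [abs_zero, zero_add] at h
  linarith

/-- The function whose pairing with `t` is `|t| ^ p`. -/
def dualPower (p t : ℝ) : ℝ := max t 0 ^ (p - 1) - max (-t) 0 ^ (p - 1)

lemma dualPower_of_nonneg {p t : ℝ} (hp : 1 < p) (ht : 0 ≤ t) : dualPower p t = t ^ (p - 1) := by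
  simp [dualPower, ht, Real.zero_rpow (sub_ne_zero.2 hp.ne')]

lemma dualPower_of_nonpos {p t : ℝ} (hp : 1 < p) (ht : t ≤ 0) :
    dualPower p t = -(-t) ^ (p - 1) := by
  simp [dualPower, ht, Real.zero_rpow (sub_ne_zero.2 hp.ne')]

lemma continuous_dualPower {p : ℝ} (hp : 1 < p) : Continuous (dualPower p) := by
  have h : 0 ≤ p - 1 := by linarith
  exact ((continuous_id.max continuous_const).rpow_const fun _ => Or.inr h).sub
    ((continuous_neg.max continuous_const).rpow_const fun _ => Or.inr h)

lemma abs_dualPower {p : ℝ} (hp : 1 < p) (t : ℝ) : |dualPower p t| = |t| ^ (p - 1) := by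
  rcases le_total 0 t with ht | ht
  · rw [dualPower_of_nonneg hp ht, abs_of_nonneg ht, abs_of_nonneg (Real.rpow_nonneg ht _)]
  · rw [dualPower_of_nonpos hp ht, abs_neg, abs_of_nonpos ht,
      abs_of_nonneg (Real.rpow_nonneg (neg_nonneg.2 ht) _)]

lemma mul_dualPower {p : ℝ} (hp : 1 < p) (t : ℝ) : t * dualPower p t = |t| ^ p := by
  have h : ∀ s : ℝ, 0 ≤ s → s * s ^ (p - 1) = s ^ p := fun s hs => by
    rw [mul_comm, ← Real.rpow_add_one' hs (by simp; linarith), sub_add_cancel]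
  rcases le_total 0 t with ht | ht
  · rw [dualPower_of_nonneg hp ht, abs_of_nonneg ht, h t ht]
  · rw [dualPower_of_nonpos hp ht, abs_of_nonpos ht, ← h (-t) (neg_nonneg.2 ht)]
    ring

theorem exists_integral_abs_increment_rpow_le {p : ℝ} (hp : 1 < p) :
    ∃ C : ℝ, 0 ≤ C ∧ ∀ (a b : E) (u v : E → ℝ), IsTest u → IsTest v →
      ∀ c, c = a ∨ c = b →
        ∫ x, |increment c u x| ^ p ∂μ ≤
          C * (∫ x, |discreteDiv a b u v x| ^ p ∂μ + ∫ x, |discreteCurl a b u v x| ^ p ∂μ) := by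
  have hpq := Real.HolderConjugate.conjExponent hp
  set q := p.conjExponent
  obtain ⟨C, hC, h⟩ := exists_integral_increment_mul_le (E := E) μ hpq
  have hq : 0 < q - 1 := hpq.symm.sub_one_pos
  set ε : ℝ := (2 * C + 1) ^ (-(q - 1)⁻¹) with hε
  have hε0 : 0 < ε := by positivity
  have hεq : ε ^ (q - 1) = (2 * C + 1)⁻¹ := by
    rw [hε, ← Real.rpow_mul (by positivity), neg_mul, inv_mul_cancel₀ hq.ne',
      Real.rpow_neg_one]
  refine ⟨2 * C / ε, by positivity, fun a b u v hu hv c hc => ?_⟩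
  have ht := hu.increment c
  have hφ : IsTest fun x => ε * dualPower p (increment c u x) :=
    (ht.comp (continuous_dualPower hp) (by
      rw [dualPower_of_nonneg hp le_rfl, Real.zero_rpow (by linarith)])).const_mul ε
  have key := h a b u v _ hu hv hφ c hc
  set D := ∫ x, |discreteDiv a b u v x| ^ p ∂μ
  set W := ∫ x, |discreteCurl a b u v x| ^ p ∂μ
  set H := ∫ x, |increment c u x| ^ p ∂μ with hH
  have hH0 : 0 ≤ H := integral_nonneg fun x => Real.rpow_nonneg (abs_nonneg _) _
  have e1 : ∫ x, increment c u x * (ε * dualPower p (increment c u x)) ∂μ = ε * H := by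
    rw [hH, ← integral_const_mul]
    refine integral_congr_ae (ae_of_all _ fun x => ?_)
    simp only
    rw [← mul_dualPower hp]
    ring
  have e2 : ∫ x, |ε * dualPower p (increment c u x)| ^ q ∂μ = ε * (2 * C + 1)⁻¹ * H := by
    rw [hH, ← integral_const_mul]
    refine integral_congr_ae (ae_of_all _ fun x => ?_)
    simp only
    rw [abs_mul, abs_of_pos hε0, abs_dualPower hp, Real.mul_rpow hε0.le (by positivity),
      ← Real.rpow_mul (abs_nonneg _), hpq.sub_one_mul_conj, ← hεq, mul_comm ε,
      ← Real.rpow_add_one hε0.ne', sub_add_cancel]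
  rw [e1, e2, abs_of_nonneg (by positivity)] at key
  have hhalf : C * (ε * (2 * C + 1)⁻¹ * H) ≤ ε * H / 2 := by
    have : C * (2 * C + 1)⁻¹ ≤ 1 / 2 := by
      rw [← div_eq_mul_inv, div_le_div_iff₀ (by positivity) two_pos]
      linarith
    calc C * (ε * (2 * C + 1)⁻¹ * H) = (C * (2 * C + 1)⁻¹) * (ε * H) := by ring
      _ ≤ 1 / 2 * (ε * H) := by gcongr
      _ = _ := by ring
  rw [div_mul_eq_mul_div, le_div_iff₀ hε0]
  linarith

end Discrete

section Limit

variable {E : Type*} [NormedAddCommGroup E]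

/-- Pointwise convergence, with uniformly bounded values and supports. -/
def BoundedlyTendsto (F : ℕ → E → ℝ) (f : E → ℝ) : Prop :=
  (∃ M R : ℝ, ∀ n x, |F n x| ≤ (Metric.closedBall 0 R).indicator (fun _ => M) x) ∧
    ∀ x, Filter.Tendsto (fun n => F n x) Filter.atTop (nhds (f x))

namespace BoundedlyTendsto

variable {F G : ℕ → E → ℝ} {f g : E → ℝ}

lemma neg (hF : BoundedlyTendsto F f) : BoundedlyTendsto (fun n x => -F n x) fun x => -f x := by
  obtain ⟨⟨M, R, h⟩, hlim⟩ := hF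
  exact ⟨⟨M, R, fun n x => by simpa using h n x⟩, fun x => (hlim x).neg⟩

lemma add (hF : BoundedlyTendsto F f) (hG : BoundedlyTendsto G g) :
    BoundedlyTendsto (fun n x => F n x + G n x) fun x => f x + g x := by
  obtain ⟨⟨M, R, hM⟩, hf⟩ := hF
  obtain ⟨⟨M', R', hM'⟩, hg⟩ := hG
  refine ⟨⟨|M| + |M'|, max R R', fun n x => ?_⟩, fun x => (hf x).add (hg x)⟩
  refine (abs_add_le _ _).trans ((add_le_add (hM n x) (hM' n x)).trans ?_)
  have enlarge : ∀ {S N : ℝ}, S ≤ max R R' → (Metric.closedBall (0 : E) S).indicator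
      (fun _ => N) x ≤ (Metric.closedBall (0 : E) (max R R')).indicator (fun _ => |N|) x :=
    fun {S N} hS => (Set.indicator_le_indicator (le_abs_self N)).trans
      (Set.indicator_le_indicator_of_subset (Metric.closedBall_subset_closedBall hS)
        (fun _ => abs_nonneg N) x)
  refine (add_le_add (enlarge (le_max_left _ _)) (enlarge (le_max_right _ _))).trans ?_
  exact (congrFun (Set.indicator_add _ (fun _ => |M|) fun _ => |M'|) x).ge

lemma sub (hF : BoundedlyTendsto F f) (hG : BoundedlyTendsto G g) :
    BoundedlyTendsto (fun n x => F n x - G n x) fun x => f x - g x := by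
  simpa only [sub_eq_add_neg] using hF.add hG.neg

lemma tendsto_integral_abs_rpow [ProperSpace E] [MeasurableSpace E] [BorelSpace E]
    {μ : Measure E} [IsFiniteMeasureOnCompacts μ] (hF : BoundedlyTendsto F f)
    (hc : ∀ n, Continuous (F n)) {p : ℝ} (hp : 0 < p) :
    Filter.Tendsto (fun n => ∫ x, |F n x| ^ p ∂μ) Filter.atTop (nhds (∫ x, |f x| ^ p ∂μ)) := by
  obtain ⟨⟨M, R, hM⟩, hf⟩ := hF
  refine tendsto_integral_of_dominated_convergence
    ((Metric.closedBall 0 R).indicator fun _ => M ^ p)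
    (fun n => ((hc n).abs.rpow_const fun _ => Or.inr hp.le).aestronglyMeasurable) ?_
    (fun n => ae_of_all _ fun x => ?_)
    (ae_of_all _ fun x => ((hf x).abs).rpow_const (Or.inr hp.le))
  · exact (integrable_indicator_iff measurableSet_closedBall).2
      (integrableOn_const (isCompact_closedBall 0 R).measure_lt_top.ne)
  · rw [Real.norm_of_nonneg (by positivity)]
    have h := hM n x
    by_cases hx : x ∈ Metric.closedBall 0 R
    · rw [Set.indicator_of_mem hx] at h ⊢
      exact Real.rpow_le_rpow (abs_nonneg _) h hp.le
    · rw [Set.indicator_of_notMem hx] at h ⊢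
      rw [le_antisymm h (abs_nonneg _), Real.zero_rpow hp.ne']

end BoundedlyTendsto

lemma IsTest.eLpNorm_eq [MeasurableSpace E] [BorelSpace E] (μ : Measure E)
    [IsFiniteMeasureOnCompacts μ] {f : E → ℝ} (hf : IsTest f) {p : ℝ} (hp : 0 < p) :
    eLpNorm f (ENNReal.ofReal p) μ = ENNReal.ofReal ((∫ x, |f x| ^ p ∂μ) ^ p⁻¹) := by
  have h := (hf.1.memLp_of_hasCompactSupport (p := ENNReal.ofReal p) (μ := μ)
    hf.2).eLpNorm_eq_integral_rpow_norm (by simpa using hp) ENNReal.ofReal_ne_top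
  simpa only [ENNReal.toReal_ofReal hp.le, Real.norm_eq_abs] using h

variable [NormedSpace ℝ E]

lemma boundedlyTendsto_increment {u : E → ℝ} (hu : ContDiff ℝ 1 u) (hs : HasCompactSupport u)
    (e : E) :
    BoundedlyTendsto
      (fun n => increment (((n : ℝ) + 1)⁻¹ • e) fun x => ((n : ℝ) + 1) * u x)
      fun x => fderiv ℝ u x e := by
  obtain ⟨K, hK⟩ := hu.lipschitzWith_of_hasCompactSupport hs one_ne_zero
  obtain ⟨R, hR⟩ := hs.isCompact.isBounded.subset_closedBall 0
  refine ⟨⟨K * ‖e‖, R + ‖e‖, fun n x => ?_⟩, fun x => ?_⟩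
  · have hn : (0 : ℝ) < n + 1 := by positivity
    have h1 : ‖((n : ℝ) + 1)⁻¹ • e‖ = ((n : ℝ) + 1)⁻¹ * ‖e‖ := by
      rw [norm_smul, Real.norm_of_nonneg (by positivity)]
    simp only [increment]
    by_cases hx : x ∈ Metric.closedBall 0 (R + ‖e‖)
    · rw [Set.indicator_of_mem hx, ← mul_sub, abs_mul, abs_of_pos hn]
      have h2 := hK.dist_le_mul (x + ((n : ℝ) + 1)⁻¹ • e) x
      rw [Real.dist_eq, dist_eq_norm, add_sub_cancel_left, h1] at h2
      calc ((n : ℝ) + 1) * |u (x + ((n : ℝ) + 1)⁻¹ • e) - u x|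
          ≤ (n + 1) * (K * (((n : ℝ) + 1)⁻¹ * ‖e‖)) := by gcongr
        _ = K * ‖e‖ := by field_simp
    · have zero : ∀ y, R < ‖y‖ → u y = 0 := fun y hy => by
        by_contra h
        have := hR (subset_tsupport u h)
        rw [mem_closedBall_zero_iff] at this
        linarith
      rw [mem_closedBall_zero_iff, not_le] at hx
      have h3 : ‖((n : ℝ) + 1)⁻¹ • e‖ ≤ ‖e‖ := by
        rw [h1]
        refine mul_le_of_le_one_left (norm_nonneg _) (inv_le_one_of_one_le₀ ?_)
        have : (0 : ℝ) ≤ n := by positivity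
        linarith
      have h4 := norm_sub_le_norm_add x (((n : ℝ) + 1)⁻¹ • e)
      rw [zero _ (by linarith), zero _ (by linarith [norm_nonneg e])]
      simpa using Set.indicator_nonneg (fun _ _ => by positivity) x
  · have h := ((hu.differentiable one_ne_zero x).hasFDerivAt.lim_real e).comp
      (tendsto_natCast_atTop_atTop.atTop_add (tendsto_const_nhds (x := (1 : ℝ))))
    simpa only [Function.comp_def, smul_eq_mul, mul_sub, increment] using h

lemma isTest_fderiv_apply {u : E → ℝ} (hu : ContDiff ℝ 1 u) (hs : HasCompactSupport u) (e : E) :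
    IsTest fun x => fderiv ℝ u x e :=
  ⟨(hu.continuous_fderiv one_ne_zero).clm_apply continuous_const, hs.fderiv_apply ℝ e⟩

variable [ProperSpace E] [MeasurableSpace E] [BorelSpace E] (μ : Measure E)
  [μ.IsAddRightInvariant] [IsFiniteMeasureOnCompacts μ]

/-- Planar derivatives are controlled by planar divergence and curl, in integral form. -/
theorem exists_integral_abs_fderiv_rpow_le {p : ℝ} (hp : 1 < p) :
    ∃ C : ℝ, 0 ≤ C ∧ ∀ (e₁ e₂ : E) (u v : E → ℝ), ContDiff ℝ 1 u → HasCompactSupport u →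
      ContDiff ℝ 1 v → HasCompactSupport v → ∀ c, c = e₁ ∨ c = e₂ →
        ∫ x, |fderiv ℝ u x c| ^ p ∂μ ≤
          C * (∫ x, |fderiv ℝ u x e₁ + fderiv ℝ v x e₂| ^ p ∂μ +
            ∫ x, |fderiv ℝ v x e₁ - fderiv ℝ u x e₂| ^ p ∂μ) := by
  obtain ⟨C, hC, h⟩ := exists_integral_abs_increment_rpow_le (E := E) μ hp
  refine ⟨C, hC, fun e₁ e₂ u v hu hus hv hvs c hc => ?_⟩
  have hp0 : 0 < p := by linarith
  set s : ℕ → ℝ := fun n => ((n : ℝ) + 1)⁻¹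
  set U : ℕ → E → ℝ := fun n x => ((n : ℝ) + 1) * u x
  set V : ℕ → E → ℝ := fun n x => ((n : ℝ) + 1) * v x
  have hU : ∀ n, IsTest (U n) := fun n => IsTest.const_mul ⟨hu.continuous, hus⟩ _
  have hV : ∀ n, IsTest (V n) := fun n => IsTest.const_mul ⟨hv.continuous, hvs⟩ _
  have hdiv : BoundedlyTendsto (fun n => discreteDiv (s n • e₁) (s n • e₂) (U n) (V n))
      fun x => fderiv ℝ u x (-e₁) + fderiv ℝ v x (-e₂) := by
    have h := (boundedlyTendsto_increment hu hus (-e₁)).add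
      (boundedlyTendsto_increment hv hvs (-e₂))
    simp only [smul_neg] at h
    exact h
  have hcurl : BoundedlyTendsto (fun n => discreteCurl (s n • e₁) (s n • e₂) (U n) (V n))
      fun x => fderiv ℝ v x e₁ - fderiv ℝ u x e₂ :=
    (boundedlyTendsto_increment hv hvs e₁).sub (boundedlyTendsto_increment hu hus e₂)
  have lim_div := hdiv.tendsto_integral_abs_rpow (μ := μ)
    (fun n => ((hU n).discreteDiv (hV n) _ _).1) hp0
  have lim_curl := hcurl.tendsto_integral_abs_rpow (μ := μ)
    (fun n => ((hU n).discreteCurl (hV n) _ _).1) hp0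
  have lim_inc := (boundedlyTendsto_increment hu hus c).tendsto_integral_abs_rpow (μ := μ)
    (fun n => ((hU n).increment (s n • c)).1) hp0
  simp only [map_neg, ← neg_add, abs_neg] at lim_div
  exact le_of_tendsto_of_tendsto' lim_inc ((lim_div.add lim_curl).const_mul C) fun n =>
    h _ _ _ _ (hU n) (hV n) _ (hc.imp (congrArg _) (congrArg _))

/-- Planar derivatives are controlled by planar divergence and curl. -/
theorem exists_eLpNorm_fderiv_le {p : ℝ} (hp : 1 < p) :
    ∃ C : ℝ, 0 ≤ C ∧ ∀ (e₁ e₂ : E) (u v : E → ℝ), ContDiff ℝ 1 u → HasCompactSupport u →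
      ContDiff ℝ 1 v → HasCompactSupport v → ∀ c, c = e₁ ∨ c = e₂ →
        eLpNorm (fun x => fderiv ℝ u x c) (ENNReal.ofReal p) μ ≤ ENNReal.ofReal C *
          (eLpNorm (fun x => fderiv ℝ u x e₁ + fderiv ℝ v x e₂) (ENNReal.ofReal p) μ +
            eLpNorm (fun x => fderiv ℝ v x e₁ - fderiv ℝ u x e₂) (ENNReal.ofReal p) μ) := by
  obtain ⟨C, hC, h⟩ := exists_integral_abs_fderiv_rpow_le (E := E) μ hp
  refine ⟨C ^ p⁻¹, by positivity, fun e₁ e₂ u v hu hus hv hvs c hc => ?_⟩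
  have hp0 : 0 < p := by linarith
  have tu := isTest_fderiv_apply hu hus
  have tv := isTest_fderiv_apply hv hvs
  have hI : ∀ f : E → ℝ, 0 ≤ ∫ x, |f x| ^ p ∂μ := fun f =>
    integral_nonneg fun x => Real.rpow_nonneg (abs_nonneg _) _
  have hD := hI fun x => fderiv ℝ u x e₁ + fderiv ℝ v x e₂
  have hW := hI fun x => fderiv ℝ v x e₁ - fderiv ℝ u x e₂
  rw [(tu c).eLpNorm_eq μ hp0, ((tu e₁).add (tv e₂)).eLpNorm_eq μ hp0,
    ((tv e₁).sub (tu e₂)).eLpNorm_eq μ hp0, ← ENNReal.ofReal_add (by positivity) (by positivity),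
    ← ENNReal.ofReal_mul (by positivity)]
  refine ENNReal.ofReal_le_ofReal ?_
  calc _ ≤ _ := Real.rpow_le_rpow (hI _) (h e₁ e₂ u v hu hus hv hvs c hc) (by positivity)
    _ ≤ _ := by
      rw [Real.mul_rpow hC (add_nonneg hD hW)]
      exact mul_le_mul_of_nonneg_left (Real.rpow_add_le_add_rpow hD hW (by positivity)
        (inv_le_one_of_one_le₀ hp.le)) (by positivity)

end Limit

/-- Lemma 2.1 (first estimate): `‖∇u^h‖_{L^r} ≤ C(‖∂₃u‖_{L^r} + ‖ω³‖_{L^r})`, `1 < r < ∞`,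
for smooth compactly supported divergence-free `u` on `ℝ³`. -/
theorem stmt_4 (r : ℝ) (hr1 : 1 < r) :
    ∃ C : ℝ, 0 < C ∧ ∀ u : Fin 3 → E3 → ℝ,
      (∀ i, ContDiff ℝ (⊤ : ℕ∞) (u i)) → (∀ i, HasCompactSupport (u i)) →
      (∀ x, pd 0 (u 0) x + pd 1 (u 1) x + pd 2 (u 2) x = 0) →
      eLpNorm (fun x => Real.sqrt (∑ i : Fin 3, ∑ h : Fin 2, (pd i (u h.castSucc) x) ^ 2))
          (ENNReal.ofReal r) volume ≤
        ENNReal.ofReal C *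
          (eLpNorm (fun x => Real.sqrt (∑ i : Fin 3, (pd 2 (u i) x) ^ 2))
              (ENNReal.ofReal r) volume +
            eLpNorm (fun x => pd 0 (u 1) x - pd 1 (u 0) x) (ENNReal.ofReal r) volume) := by
  obtain ⟨C, hC, h⟩ := exists_eLpNorm_fderiv_le (E := E3) volume hr1
  refine ⟨4 * C + 2, by positivity, fun u hu hs hdiv => ?_⟩
  set X := eLpNorm (fun x => Real.sqrt (∑ i : Fin 3, (pd 2 (u i) x) ^ 2))
    (ENNReal.ofReal r) volume with hX
  set W := eLpNorm (fun x => pd 0 (u 1) x - pd 1 (u 0) x) (ENNReal.ofReal r) volume with hW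
  have hu1 : ∀ i, ContDiff ℝ 1 (u i) := fun i => (hu i).of_le (by exact_mod_cast le_top)
  have test : ∀ i j, IsTest (pd i (u j)) := fun i j => isTest_fderiv_apply (hu1 j) (hs j) _
  have vertical : ∀ i, eLpNorm (pd 2 (u i)) (ENNReal.ofReal r) volume ≤ X := fun i =>
    eLpNorm_mono_real fun x => Real.abs_le_sqrt <|
      Finset.single_le_sum (f := fun i => pd 2 (u i) x ^ 2) (fun _ _ => sq_nonneg _)
        (Finset.mem_univ i)
  have div_le : eLpNorm (fun x => pd 0 (u 0) x + pd 1 (u 1) x) (ENNReal.ofReal r) volume ≤ X := by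
    refine le_trans (le_of_eq ?_) (vertical 2)
    rw [← eLpNorm_neg (pd 2 (u 2))]
    congr 1
    ext x
    exact eq_neg_of_add_eq_zero_left (hdiv x)
  have first : ∀ i : Fin 3, i = 0 ∨ i = 1 →
      eLpNorm (pd i (u 0)) (ENNReal.ofReal r) volume ≤ ENNReal.ofReal C * (X + W) := fun i hi =>
    (h (EuclideanSpace.single 0 1) (EuclideanSpace.single 1 1) (u 0) (u 1) (hu1 0) (hs 0) (hu1 1)
      (hs 1) (EuclideanSpace.single i 1) (by
        rcases hi with rfl | rfl
        exacts [.inl rfl, .inr rfl])).trans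
      (mul_le_mul_right (add_le_add div_le le_rfl) _)
  have second : ∀ i : Fin 3, i = 0 ∨ i = 1 →
      eLpNorm (pd i (u 1)) (ENNReal.ofReal r) volume ≤ ENNReal.ofReal C * (X + W) := fun i hi => by
    refine (h (EuclideanSpace.single 1 1) (EuclideanSpace.single 0 1) (u 1) (u 0) (hu1 1) (hs 1)
      (hu1 0) (hs 0) (EuclideanSpace.single i 1)
      (by
        rcases hi with rfl | rfl
        exacts [.inr rfl, .inl rfl])).trans
      (mul_le_mul_right (add_le_add (le_trans (le_of_eq ?_) div_le) (le_of_eq ?_)) _)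
    · congr 1
      ext x
      exact add_comm _ _
    · rw [hW, ← eLpNorm_neg fun x => pd 0 (u 1) x - pd 1 (u 0) x]
      congr 1
      ext x
      exact (neg_sub (pd 0 (u 1) x) (pd 1 (u 0) x)).symm
  have split : eLpNorm
      (fun x => Real.sqrt (∑ i : Fin 3, ∑ h : Fin 2, (pd i (u h.castSucc) x) ^ 2))
      (ENNReal.ofReal r) volume ≤
      ∑ k : Fin 3 × Fin 2, eLpNorm (pd k.1 (u k.2.castSucc)) (ENNReal.ofReal r) volume := by
    calc _ ≤ eLpNorm (∑ k : Fin 3 × Fin 2, fun x => |pd k.1 (u k.2.castSucc) x|)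
          (ENNReal.ofReal r) volume := by
          refine eLpNorm_mono_real fun x => ?_
          rw [Real.norm_of_nonneg (Real.sqrt_nonneg _), ← Fintype.sum_prod_type',
            Finset.sum_apply]
          refine Real.sqrt_le_iff.2 ⟨Finset.sum_nonneg fun _ _ => abs_nonneg _, ?_⟩
          simpa only [sq_abs] using Finset.sum_sq_le_sq_sum_of_nonneg
            (s := Finset.univ) (f := fun k : Fin 3 × Fin 2 => |pd k.1 (u k.2.castSucc) x|)
            fun _ _ => abs_nonneg _
      _ ≤ ∑ k : Fin 3 × Fin 2, eLpNorm (fun x => |pd k.1 (u k.2.castSucc) x|)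
          (ENNReal.ofReal r) volume :=
          eLpNorm_sum_le (fun k _ => (test _ _).abs.1.aestronglyMeasurable)
            (by simpa using hr1.le)
      _ = _ := Finset.sum_congr rfl fun k _ => eLpNorm_norm (pd k.1 (u k.2.castSucc))
  refine split.trans ?_
  rw [Fintype.sum_prod_type]
  simp only [Fin.sum_univ_three, Fin.sum_univ_two]
  have hXW : X ≤ X + W := le_self_add
  calc _ ≤ (ENNReal.ofReal C * (X + W) + ENNReal.ofReal C * (X + W)) +
        (ENNReal.ofReal C * (X + W) + ENNReal.ofReal C * (X + W)) + ((X + W) + (X + W)) := by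
        gcongr
        exacts [first 0 (.inl rfl), second 0 (.inl rfl), first 1 (.inr rfl), second 1 (.inr rfl),
          (vertical 0).trans hXW, (vertical 1).trans hXW]
    _ = ENNReal.ofReal (4 * C + 2) * (X + W) := by
        rw [ENNReal.ofReal_add (by positivity) two_pos.le, ENNReal.ofReal_mul (by norm_num),
          ENNReal.ofReal_ofNat, ENNReal.ofReal_ofNat]
        ring
end
end
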